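/- arXiv:1504.07306 — 2 statements merged into one kernel-verified Lean document; each statement's English description precedes it below -/
import Mathlib

section
/- Let f : (0,∞) → ℝ be continuous with |f(p)| ≤ C_f (1+p²)^{-1/2} for some C_f > 0, and suppose f > ε on an interval (a,b) with 0 < a < b and ε > 0. Set δ = (b²-a²)/4 and T_* = (δ/2)·exp(-(2C_f(√(1+2b²) + 1/(2b)))/(εδ)). Then for every μ ∈ (a²+δ, b²-δ) and every T ∈ (0, T_*), one has ∫₀^∞ (p/K_T(p)) f(p) dp > 0, where K_T(p) = (p²-μ)/tanh((p²-μ)/(2T)). -/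
/-- The BCS effective gap symbol, extended continuously by `2*T` at `p² = μ`. -/
noncomputable def Kfun (T μ p : ℝ) : ℝ :=
  if p^2 = μ then 2*T else (p^2 - μ) / Real.tanh ((p^2 - μ)/(2*T))

lemma aux_tanh_pos {x : ℝ} (hx : 0 < x) : 0 < Real.tanh x := by
  rw [Real.tanh_eq_sinh_div_cosh]
  exact div_pos (Real.sinh_pos_iff.2 hx) (Real.cosh_pos x)

lemma aux_tanh_le {x : ℝ} (hx : 0 < x) : Real.tanh x ≤ 2 * x := by
  rw [Real.tanh_eq, div_le_iff₀ (by positivity)]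
  have h1 : Real.exp (-x) = Real.exp x * Real.exp (-(2*x)) := by
    rw [← Real.exp_add]; congr 1; ring
  have h2 : -(2*x) + 1 ≤ Real.exp (-(2*x)) := Real.add_one_le_exp _
  have h3 : 0 < Real.exp (-x) := Real.exp_pos _
  have h4 : 0 < Real.exp x := Real.exp_pos _
  have h5 : Real.exp x * (-(2*x) + 1) ≤ Real.exp (-x) := by
    rw [h1]; exact mul_le_mul_of_nonneg_left h2 h4.le
  nlinarith [mul_pos hx h3]

lemma aux_tanh_ge {x : ℝ} (hx : 1 ≤ x) : 5/8 ≤ Real.tanh x := by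
  rw [Real.tanh_eq, le_div_iff₀ (by positivity)]
  have h0 : Real.exp 1 ≤ Real.exp x := Real.exp_le_exp.2 hx
  have h1 := Real.exp_one_gt_d9
  have h2 : Real.exp (-x) * Real.exp x = 1 := by
    rw [← Real.exp_add]; simp
  have h3 : 0 < Real.exp (-x) := Real.exp_pos _
  nlinarith

lemma aux_K_abs {T μ p : ℝ} (h : p^2 ≠ μ) :
    (Kfun T μ p)⁻¹ = Real.tanh (|p^2-μ|/(2*T)) / |p^2-μ| := by
  unfold Kfun
  rw [if_neg h]
  rcases abs_cases (p^2-μ) with ⟨h1, _⟩ | ⟨h1, _⟩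
  · rw [h1, inv_div]
  · rw [h1, inv_div, neg_div, Real.tanh_neg, neg_div_neg_eq]

lemma aux_K_pos {T μ p : ℝ} (hT : 0 < T) : 0 < (Kfun T μ p)⁻¹ := by
  by_cases h : p^2 = μ
  · unfold Kfun; rw [if_pos h]; positivity
  · rw [aux_K_abs h]
    have : 0 < |p^2-μ| := abs_pos.2 (sub_ne_zero.2 h)
    exact div_pos (aux_tanh_pos (by positivity)) this

lemma aux_K_le {T μ p : ℝ} (hT : 0 < T) : (Kfun T μ p)⁻¹ ≤ 1/T := by
  by_cases h : p^2 = μ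
  · unfold Kfun; rw [if_pos h, ← one_div]
    exact one_div_le_one_div_of_le hT (by linarith)
  · rw [aux_K_abs h]
    have h1 : 0 < |p^2-μ| := abs_pos.2 (sub_ne_zero.2 h)
    rw [div_le_iff₀ h1]
    refine (aux_tanh_le (by positivity)).trans (le_of_eq ?_)
    field_simp

lemma aux_K_le' {T μ p d : ℝ} (hd : 0 < d) (h : d ≤ |p^2-μ|) :
    (Kfun T μ p)⁻¹ ≤ 1/d := by
  have hne : p^2 ≠ μ := by
    intro h0; rw [h0] at h; simp at h; linarith
  rw [aux_K_abs hne]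
  exact div_le_div₀ zero_le_one (Real.tanh_lt_one _).le hd h

lemma aux_K_ge {T μ p : ℝ} (hT : 0 < T) (h : 2*T ≤ |p^2-μ|) :
    5/8 / |p^2-μ| ≤ (Kfun T μ p)⁻¹ := by
  have hne : p^2 ≠ μ := by
    intro h0; rw [h0] at h; simp at h; linarith
  rw [aux_K_abs hne]
  have h1 : 0 < |p^2-μ| := abs_pos.2 (sub_ne_zero.2 hne)
  have : 1 ≤ |p^2-μ|/(2*T) := by rw [le_div_iff₀ (by positivity)]; linarith
  exact div_le_div_of_nonneg_right (aux_tanh_ge this) h1.le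

lemma aux_meas (T μ : ℝ) : Measurable (fun p => Kfun T μ p) := by
  have ht : Measurable Real.tanh := by
    have : Real.tanh = fun x => Real.sinh x / Real.cosh x := by
      funext x; exact Real.tanh_eq_sinh_div_cosh x
    rw [this]
    exact Real.measurable_sinh.div Real.measurable_cosh
  unfold Kfun
  refine Measurable.ite ?_ measurable_const ?_
  · exact measurableSet_eq_fun (by fun_prop) (by fun_prop)
  · exact Measurable.div (by fun_prop) (ht.comp (by fun_prop))

/-- integral of `p/(μ - p²)` or `p/(p²-μ)` in log form -/
lemma aux_log {μ x y : ℝ} (hxy : x ≤ y) (h : ∀ p ∈ Set.Icc x y, p^2 - μ ≠ 0) :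
    IntervalIntegrable (fun p : ℝ => p / (p^2-μ)) MeasureTheory.volume x y ∧
    ∫ p in x..y, p / (p^2-μ) = 1/2 * Real.log (y^2-μ) - 1/2 * Real.log (x^2-μ) := by
  have hi : IntervalIntegrable (fun p : ℝ => p / (p^2-μ)) MeasureTheory.volume x y := by
    apply ContinuousOn.intervalIntegrable
    rw [Set.uIcc_of_le hxy]
    exact ContinuousOn.div (by fun_prop) (by fun_prop) h
  refine ⟨hi, ?_⟩
  refine intervalIntegral.integral_eq_sub_of_hasDerivAt
    (f := fun p => 1/2 * Real.log (p^2-μ)) ?_ hi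
  intro p hp
  rw [Set.uIcc_of_le hxy] at hp
  have := ((((hasDerivAt_pow 2 p).sub_const μ).log (h p hp)).const_mul (1/2))
  refine HasDerivAt.congr_deriv this ?_
  push_cast; ring

lemma aux_decay {p : ℝ} (hp : 0 < p) : p * (1 + p^2) ^ (-(1:ℝ)/2) ≤ 1 := by
  have h1 : (1 + p^2 : ℝ) ^ (-(1:ℝ)/2) = (Real.sqrt (1+p^2))⁻¹ := by
    rw [neg_div, Real.rpow_neg (by positivity), Real.sqrt_eq_rpow]
  have h2 : p ≤ Real.sqrt (1+p^2) := Real.le_sqrt_of_sq_le (by linarith)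
  rw [h1, ← div_eq_mul_inv]
  exact div_le_one_of_le₀ h2 (Real.sqrt_nonneg _)

set_option maxHeartbeats 1600000 in
open MeasureTheory Set in
theorem stmt12 (f : ℝ → ℝ) (Cf ε a b : ℝ)
    (hCf : 0 < Cf) (hε : 0 < ε) (ha : 0 < a) (hab : a < b)
    (hcont : ContinuousOn f (Set.Ioi 0))
    (hbound : ∀ p : ℝ, 0 < p → |f p| ≤ Cf * (1 + p^2) ^ (-(1:ℝ)/2))
    (hpos : ∀ p ∈ Set.Ioo a b, ε < f p) :
    ∀ μ ∈ Set.Ioo (a^2 + (b^2 - a^2)/4) (b^2 - (b^2 - a^2)/4),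
    ∀ T ∈ Set.Ioo (0:ℝ)
      ((((b^2 - a^2)/4)/2) *
        Real.exp (-(2*Cf*(Real.sqrt (1 + 2*b^2) + 1/(2*b)))/(ε*((b^2 - a^2)/4)))),
    0 < ∫ p in Set.Ioi (0:ℝ), (p / Kfun T μ p) * f p := by
  rintro μ ⟨hμ1, hμ2⟩ T ⟨hT, hTs⟩
  have hb : 0 < b := ha.trans hab
  set δ := (b^2 - a^2)/4 with hδ
  have hδ0 : 0 < δ := by rw [hδ]; nlinarith
  have hδb : 4 * δ ≤ b^2 := by rw [hδ]; nlinarith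
  set g : ℝ → ℝ := fun p => (p / Kfun T μ p) * f p with hg
  -- logarithm
  set M := (2*Cf*(Real.sqrt (1 + 2*b^2) + 1/(2*b)))/(ε*δ) with hM
  have hM0 : 0 < M := by positivity
  have hL : M < Real.log δ - Real.log (2*T) := by
    rw [← Real.log_div hδ0.ne' (by positivity), Real.lt_log_iff_exp_lt (by positivity),
      lt_div_iff₀ (by positivity)]
    rw [neg_div, Real.exp_neg] at hTs
    have h1 := Real.exp_pos M
    have h2 : T * Real.exp M < δ/2 := by
      rw [← div_eq_mul_inv, lt_div_iff₀ h1] at hTs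
      exact hTs
    linarith
  have hTδ : 2 * T < δ := by
    rw [← Real.log_lt_log_iff (by positivity) hδ0]; linarith
  set s2 := Real.sqrt 2 with hs2
  have hs2sq : s2^2 = 2 := Real.sq_sqrt (by norm_num)
  have hs2one : 1 < s2 := by rw [hs2]; exact Real.lt_sqrt_of_sq_lt (by norm_num)
  set B := s2 * b with hB
  have hB2 : B^2 = 2*b^2 := by rw [hB, mul_pow, hs2sq]
  have hbB : b < B := by rw [hB]; nlinarith
  have hB0 : 0 < B := hb.trans hbB
  -- pointwise bounds
  have hgb : ∀ p, 0 < p → ‖g p‖ ≤ Cf * (Kfun T μ p)⁻¹ := by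
    intro p hp
    have h1 := aux_K_pos (μ := μ) (p := p) hT
    have h2 := aux_decay hp
    have h3 := hbound p hp
    rw [hg]
    simp only [Real.norm_eq_abs, abs_mul, div_eq_mul_inv]
    rw [abs_of_pos hp, abs_of_pos h1]
    calc p * (Kfun T μ p)⁻¹ * |f p| ≤ p * (Kfun T μ p)⁻¹ * (Cf * (1 + p^2) ^ (-(1:ℝ)/2)) := by
          gcongr
      _ = Cf * (Kfun T μ p)⁻¹ * (p * (1 + p^2) ^ (-(1:ℝ)/2)) := by ring
      _ ≤ Cf * (Kfun T μ p)⁻¹ * 1 := by gcongr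
      _ = _ := by ring
  have htail : ∀ p, B < p → ‖g p‖ ≤ 2 * Cf * p ^ (-2:ℝ) := by
    intro p hp
    have hp0 := hB0.trans hp
    have hp2 : 2*b^2 < p^2 := by rw [← hB2]; nlinarith
    have h1 : p^2/2 ≤ |p^2-μ| := by
      refine le_trans ?_ (le_abs_self _); linarith
    have h2 := aux_K_le' (T := T) (by positivity) h1
    refine (hgb p hp0).trans ?_
    rw [Real.rpow_neg hp0.le]
    calc Cf * (Kfun T μ p)⁻¹ ≤ Cf * (1/(p^2/2)) := by gcongr
      _ = _ := by norm_num; field_simp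
  -- integrability
  have hmeas : AEStronglyMeasurable g (volume.restrict (Ioi 0)) := by
    refine AEStronglyMeasurable.mul ?_ (hcont.aestronglyMeasurable measurableSet_Ioi)
    exact (measurable_id.div (aux_meas T μ)).aestronglyMeasurable
  have hpowint : IntegrableOn (fun p : ℝ => 2 * Cf * p ^ (-2:ℝ)) (Ioi B) :=
    (integrableOn_Ioi_rpow_of_lt (by norm_num) hB0).const_mul _
  have hint : IntegrableOn g (Ioi 0) := by
    rw [← Ioc_union_Ioi_eq_Ioi hB0.le]
    refine IntegrableOn.union ?_ ?_
    · refine IntegrableOn.of_bound (by simp) (hmeas.mono_set Ioc_subset_Ioi_self) (Cf * (1/T)) ?_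
      refine (ae_restrict_iff' measurableSet_Ioc).2 (Filter.Eventually.of_forall ?_)
      intro p hp
      refine (hgb p hp.1).trans ?_
      have := aux_K_le (μ := μ) (p := p) hT
      gcongr
    · refine Integrable.mono' hpowint (hmeas.mono_set (Ioi_subset_Ioi hB0.le)) ?_
      exact (ae_restrict_iff' measurableSet_Ioi).2 (Filter.Eventually.of_forall htail)
  have hii : ∀ x y, 0 ≤ x → x ≤ y → IntervalIntegrable g volume x y := by
    intro x y hx hxy
    rw [intervalIntegrable_iff_integrableOn_Ioc_of_le hxy]
    exact hint.mono_set (fun p hp => lt_of_le_of_lt hx hp.1)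
  have hiI : ∀ x, 0 ≤ x → IntegrableOn g (Ioi x) := fun x hx => hint.mono_set (Ioi_subset_Ioi hx)
  -- the points
  have hμ0 : 0 < μ - δ := by nlinarith
  obtain ⟨c1, hc1, hc1s⟩ : ∃ c, 0 < c ∧ c^2 = μ - δ :=
    ⟨_, Real.sqrt_pos.2 hμ0, Real.sq_sqrt hμ0.le⟩
  obtain ⟨d1, hd1, hd1s⟩ : ∃ c, 0 < c ∧ c^2 = μ - 2*T :=
    ⟨_, Real.sqrt_pos.2 (by linarith), Real.sq_sqrt (by linarith)⟩
  obtain ⟨d2, hd2, hd2s⟩ : ∃ c, 0 < c ∧ c^2 = μ + 2*T :=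
    ⟨_, Real.sqrt_pos.2 (by linarith), Real.sq_sqrt (by linarith)⟩
  obtain ⟨c2, hc2, hc2s⟩ : ∃ c, 0 < c ∧ c^2 = μ + δ :=
    ⟨_, Real.sqrt_pos.2 (by linarith), Real.sq_sqrt (by linarith)⟩
  have o1 : a < c1 := lt_of_pow_lt_pow_left₀ 2 hc1.le (by linarith)
  have o2 : c1 < d1 := lt_of_pow_lt_pow_left₀ 2 hd1.le (by linarith)
  have o3 : d1 < d2 := lt_of_pow_lt_pow_left₀ 2 hd2.le (by linarith)
  have o4 : d2 < c2 := lt_of_pow_lt_pow_left₀ 2 hc2.le (by linarith)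
  have o5 : c2 < b := lt_of_pow_lt_pow_left₀ 2 hb.le (by linarith)
  -- splitting
  have hsplit : ∫ p in Ioi (0:ℝ), g p = (∫ p in (0:ℝ)..a, g p) + (∫ p in a..c1, g p)
      + (∫ p in c1..d1, g p) + (∫ p in d1..d2, g p) + (∫ p in d2..c2, g p)
      + (∫ p in c2..b, g p) + (∫ p in b..B, g p) + ∫ p in Ioi B, g p := by
    rw [← intervalIntegral.integral_interval_add_Ioi (hiI 0 le_rfl) (hiI a ha.le),
      ← intervalIntegral.integral_interval_add_Ioi (hiI a ha.le) (hiI c1 hc1.le),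
      ← intervalIntegral.integral_interval_add_Ioi (hiI c1 hc1.le) (hiI d1 hd1.le),
      ← intervalIntegral.integral_interval_add_Ioi (hiI d1 hd1.le) (hiI d2 hd2.le),
      ← intervalIntegral.integral_interval_add_Ioi (hiI d2 hd2.le) (hiI c2 hc2.le),
      ← intervalIntegral.integral_interval_add_Ioi (hiI c2 hc2.le) (hiI b hb.le),
      ← intervalIntegral.integral_interval_add_Ioi (hiI b hb.le) (hiI B hB0.le)]
    ring
  -- inside
  have hgin : ∀ p ∈ Ioo a b, ε * (p * (Kfun T μ p)⁻¹) ≤ g p := by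
    intro p hp
    have h1 := aux_K_pos (μ := μ) (p := p) hT
    have h2 := hpos p hp
    have hp0 : 0 < p := ha.trans hp.1
    have : 0 < p * (Kfun T μ p)⁻¹ := by positivity
    simp only [hg, div_eq_mul_inv]
    nlinarith
  have hnn : ∀ x y, a ≤ x → x ≤ y → y ≤ b → 0 ≤ ∫ p in x..y, g p := by
    intro x y hx hxy hy
    have := intervalIntegral.integral_mono_on_of_le_Ioo (f := fun _ => (0:ℝ)) (g := g) hxy
      (by simp) (hii x y (by linarith) hxy) ?_
    · simpa using this
    · intro p hp
      have hp' : p ∈ Ioo a b := ⟨by linarith [hp.1], by linarith [hp.2]⟩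
      have h1 := aux_K_pos (μ := μ) (p := p) hT
      have hp0 : 0 < p := ha.trans hp'.1
      refine le_trans ?_ (hgin p hp')
      positivity
  have i1 := hnn a c1 le_rfl o1.le (by linarith)
  have i2 := hnn d1 d2 (by linarith) o3.le (by linarith)
  have i3 := hnn c2 b (by linarith) o5.le le_rfl
  have i4 : ε * (5/8) * (1/2 * (Real.log δ - Real.log (2*T))) ≤ ∫ p in d2..c2, g p := by
    have hlow : ∀ p ∈ Icc d2 c2, 2*T ≤ p^2 - μ := by
      intro p hp
      have : d2^2 ≤ p^2 := pow_le_pow_left₀ hd2.le hp.1 2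
      linarith
    obtain ⟨h1, h2⟩ := aux_log (μ := μ) o4.le (fun p hp => by have := hlow p hp; linarith)
    have h3 := intervalIntegral.integral_mono_on o4.le (h1.const_mul (ε * (5/8)))
      (hii d2 c2 hd2.le o4.le) ?_
    · rw [intervalIntegral.integral_const_mul, h2, hc2s, hd2s] at h3
      simp only [add_sub_cancel_left] at h3
      linarith
    · intro p hp
      have h4 := hlow p hp
      have hp0 : 0 < p := hd2.trans_le hp.1
      have h5 : |p^2-μ| = p^2-μ := abs_of_pos (by linarith)
      have h6 := aux_K_ge (μ := μ) (p := p) hT (by rw [h5]; exact h4)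
      rw [h5] at h6
      refine le_trans ?_ (hgin p ⟨by linarith [hp.1], by linarith [hp.2]⟩)
      calc ε * (5/8) * (p / (p^2-μ)) = ε * (p * (5/8/(p^2-μ))) := by ring
        _ ≤ _ := by gcongr
  have i5 : ε * (5/8) * (1/2 * (Real.log δ - Real.log (2*T))) ≤ ∫ p in c1..d1, g p := by
    have hlow : ∀ p ∈ Icc c1 d1, 2*T ≤ -(p^2 - μ) := by
      intro p hp
      have : p^2 ≤ d1^2 := pow_le_pow_left₀ (hc1.le.trans hp.1) hp.2 2
      linarith
    obtain ⟨h1, h2⟩ := aux_log (μ := μ) o2.le (fun p hp => by have := hlow p hp; linarith)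
    have h3 := intervalIntegral.integral_mono_on o2.le (h1.const_mul (-(ε * (5/8))))
      (hii c1 d1 hc1.le o2.le) ?_
    · rw [intervalIntegral.integral_const_mul, h2, hc1s, hd1s] at h3
      have e1 : μ - 2*T - μ = -(2*T) := by ring
      have e2 : μ - δ - μ = -δ := by ring
      rw [e1, e2, Real.log_neg_eq_log, Real.log_neg_eq_log] at h3
      linarith
    · intro p hp
      have h4 := hlow p hp
      have hp0 : 0 < p := hc1.trans_le hp.1
      have h5 : |p^2-μ| = -(p^2-μ) := abs_of_neg (by linarith)
      have h6 := aux_K_ge (μ := μ) (p := p) hT (by rw [h5]; exact h4)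
      rw [h5] at h6
      refine le_trans ?_ (hgin p ⟨by linarith [hp.1], by linarith [hp.2]⟩)
      calc -(ε * (5/8)) * (p / (p^2-μ)) = ε * (p * (5/8/(-(p^2-μ)))) := by
            rw [div_neg]; ring
        _ ≤ _ := by gcongr
  -- outside
  have j1 : ‖∫ p in (0:ℝ)..a, g p‖ ≤ Cf * (1/δ) * |a - 0| := by
    refine intervalIntegral.norm_integral_le_of_norm_le_const ?_
    intro p hp
    rw [uIoc_of_le ha.le] at hp
    refine (hgb p hp.1).trans ?_
    have h0 : p^2 ≤ a^2 := pow_le_pow_left₀ hp.1.le hp.2 2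
    have := aux_K_le' (T := T) (μ := μ) (p := p) hδ0
      (le_trans (by linarith) (neg_le_abs _))
    gcongr
  have j2 : ‖∫ p in b..B, g p‖ ≤ Cf * (1/δ) * |B - b| := by
    refine intervalIntegral.norm_integral_le_of_norm_le_const ?_
    intro p hp
    rw [uIoc_of_le hbB.le] at hp
    refine (hgb p (hb.trans hp.1)).trans ?_
    have h0 : b^2 ≤ p^2 := pow_le_pow_left₀ hb.le hp.1.le 2
    have := aux_K_le' (T := T) (μ := μ) (p := p) hδ0
      (le_trans (by linarith) (le_abs_self _))
    gcongr
  have j3 : ‖∫ p in Ioi B, g p‖ ≤ 2 * Cf * (1/B) := by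
    refine (norm_integral_le_of_norm_le hpowint
      ((ae_restrict_iff' measurableSet_Ioi).2 (Filter.Eventually.of_forall htail))).trans ?_
    rw [integral_const_mul, integral_Ioi_rpow_of_lt (by norm_num) hB0]
    norm_num [Real.rpow_neg_one]
  rw [sub_zero, abs_of_pos ha] at j1
  rw [abs_of_pos (by linarith)] at j2
  rw [Real.norm_eq_abs] at j1 j2 j3
  have k1 := neg_le_of_abs_le j1
  have k2 := neg_le_of_abs_le j2
  have k3 := neg_le_of_abs_le j3
  have k4 : 2 * Cf * (1/B) ≤ Cf * (1/δ) * (B/4) := by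
    have : 2 * Cf * (1/B) = Cf * (1/δ) * (2*δ/B) := by field_simp
    rw [this]
    have h : 2*δ/B ≤ B/4 := by
      rw [div_le_iff₀ hB0]
      have e : B/4*B = B^2/4 := by ring
      rw [e, hB2]; linarith
    gcongr
  have k5 : Cf * (1/δ) * a + Cf * (1/δ) * (B - b) ≤ Cf * (1/δ) * B := by
    have : 0 < Cf * (1/δ) := by positivity
    nlinarith
  have k6 : Cf * (1/δ) * B * 2 ≤ ε * M := by
    have h1 : B ≤ Real.sqrt (1 + 2*b^2) := Real.le_sqrt_of_sq_le (by linarith)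
    have h2 : ε * M = Cf * (1/δ) * (Real.sqrt (1 + 2*b^2) + 1/(2*b)) * 2 := by
      rw [hM]; field_simp
    rw [h2]
    have h3 : 0 < 1/(2*b) := by positivity
    have h4 : B ≤ Real.sqrt (1 + 2*b^2) + 1/(2*b) := by linarith
    gcongr
  have k7 : ε * M < ε * (Real.log δ - Real.log (2*T)) := by gcongr
  change 0 < ∫ p in Ioi (0:ℝ), g p
  rw [hsplit]
  linarith
end

section
/- For every ν ≥ 0 and every x > ν, the squared modulus of the Bessel functions satisfies M_ν(x)² := J_ν(x)² + Y_ν(x)² < (2/π)·1/√(x² - ν²). -/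
/-- The Bessel function of the first kind of order `ν`, via its power series. -/
noncomputable def besselJ (ν x : ℝ) : ℝ :=
  ∑' k : ℕ, ((-1)^k / (k.factorial * Real.Gamma ((k:ℝ) + ν + 1)))
    * (x/2)^(2*k) * (x/2) ^ ν

/-- The Bessel function of the second kind of order `ν`, for `x > 0`, via the
Schläfli integral representation. -/
noncomputable def besselY (ν x : ℝ) : ℝ :=
  (1/Real.pi) * (∫ θ in (0:ℝ)..Real.pi, Real.sin (x * Real.sin θ - ν*θ))
    - (1/Real.pi) * ∫ t in Set.Ioi (0:ℝ),
        (Real.exp (ν*t) + Real.exp (-ν*t) * Real.cos (ν*Real.pi)) * Real.exp (-x * Real.sinh t)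

section

open Real Set Filter Topology MeasureTheory

namespace BesselAux

/-- differentiation under an interval integral with jointly continuous data -/
lemma hasDerivAt_param {E : Type*} [NormedAddCommGroup E] [NormedSpace ℝ E]
    {F F' : ℝ → ℝ → E} (a b x : ℝ)
    (hF : Continuous (Function.uncurry F)) (hF' : Continuous (Function.uncurry F'))
    (hd : ∀ y t, HasDerivAt (fun y => F y t) (F' y t) y) :
    HasDerivAt (fun y => ∫ t in a..b, F y t) (∫ t in a..b, F' x t) x := by
  obtain ⟨C, hC⟩ := ((isCompact_closedBall x 1).prod (isCompact_uIcc (a := a) (b := b))).exists_bound_of_continuousOn hF'.continuousOn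
  have c1 : ∀ y, Continuous (F y) := fun y => hF.comp (by fun_prop : Continuous fun t => (y, t))
  have c2 : ∀ y, Continuous (F' y) := fun y => hF'.comp (by fun_prop : Continuous fun t => (y, t))
  refine (intervalIntegral.hasDerivAt_integral_of_dominated_loc_of_deriv_le (bound := fun _ => C)
    (s := Metric.closedBall x 1) (Metric.closedBall_mem_nhds x one_pos) ?_ ?_ ?_ ?_ ?_ ?_).2
  · exact Eventually.of_forall fun y => (c1 y).aestronglyMeasurable
  · exact (c1 x).intervalIntegrable _ _
  · exact (c2 x).aestronglyMeasurable
  · refine Eventually.of_forall fun t ht y hy => ?_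
    exact hC (y, t) ⟨hy, uIoc_subset_uIcc ht⟩
  · exact intervalIntegrable_const
  · exact Eventually.of_forall fun t ht y hy => hd y t

lemma sinh_ge_sq {t : ℝ} (ht : 0 ≤ t) : t ^ 2 / 4 ≤ sinh t := by
  have h1 := Real.quadratic_le_exp_of_nonneg ht
  have h2 : exp (-t) ≤ 1 := by simpa using ht
  rw [Real.sinh_eq]; nlinarith

lemma exp_sinh_bound (c ε t : ℝ) (hε : 0 < ε) (ht : 0 ≤ t) :
    exp (c * t) * exp (-ε * sinh t) ≤ exp ((c + 1) ^ 2 / ε) * exp (-t) := by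
  rw [← exp_add, ← exp_add, exp_le_exp]
  have h1 := mul_le_mul_of_nonneg_left (sinh_ge_sq ht) hε.le
  have h2 : (c + 1) ^ 2 / ε + ε * t ^ 2 / 4 - (c + 1) * t = (c + 1 - ε * t / 2) ^ 2 / ε := by
    field_simp; ring
  have h3 : 0 ≤ (c + 1 - ε * t / 2) ^ 2 / ε := by positivity
  linarith

lemma integrable_of_bound {E : Type*} [NormedAddCommGroup E] {h : ℝ → E} (c ε : ℝ)
    (hε : 0 < ε) (hc : Continuous h)
    (hb : ∀ t, 0 < t → ‖h t‖ ≤ exp (c * t) * exp (-ε * sinh t)) :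
    IntegrableOn h (Ioi 0) := by
  have h0 : IntegrableOn (fun t : ℝ => exp ((c + 1) ^ 2 / ε) * exp (-t)) (Ioi 0) :=
    (integrableOn_exp_neg_Ioi 0).const_mul _
  refine Integrable.mono' h0 hc.aestronglyMeasurable ?_
  refine (ae_restrict_iff' measurableSet_Ioi).2 (Eventually.of_forall fun t ht => ?_)
  exact (hb t ht).trans (exp_sinh_bound c ε t hε (le_of_lt ht))

lemma sinh_le_exp' (t : ℝ) : sinh t ≤ exp t := by
  rw [Real.sinh_eq]; have := exp_pos t; have := exp_pos (-t); linarith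

/-- differentiation of the Laplace type integrals -/
lemma hasDerivAt_ray {w φ : ℝ → ℝ} (c : ℝ) (hw : Continuous w) (hφ : Continuous φ)
    (hwb : ∀ t, 0 < t → |w t| ≤ exp (c * t))
    (hφ1 : ∀ t, 0 < t → sinh t ≤ φ t) (hφ2 : ∀ t, 0 < t → φ t ≤ exp t) {x : ℝ} (hx : 0 < x) :
    HasDerivAt (fun y => ∫ t in Ioi (0:ℝ), w t * exp (-y * φ t))
      (∫ t in Ioi (0:ℝ), (w t * (-φ t)) * exp (-x * φ t)) x := by
  have key : ∀ y t, 0 < t → x / 2 ≤ y → exp (-y * φ t) ≤ exp (-(x/2) * sinh t) := by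
    intro y t ht hy
    rw [exp_le_exp]
    have h1 := hφ1 t ht
    have h2 : 0 < sinh t := Real.sinh_pos_iff.2 ht
    nlinarith
  have wb : ∀ t, 0 < t → |w t * (-φ t)| ≤ exp ((c+1) * t) := by
    intro t ht
    have h2 : 0 < sinh t := Real.sinh_pos_iff.2 ht
    rw [abs_mul, abs_neg, abs_of_nonneg (h2.le.trans (hφ1 t ht)), add_mul, exp_add, one_mul]
    exact mul_le_mul (hwb t ht) (hφ2 t ht) (h2.le.trans (hφ1 t ht)) (exp_pos _).le
  refine (hasDerivAt_integral_of_dominated_loc_of_deriv_le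
    (F := fun y t => w t * exp (-y * φ t)) (F' := fun y t => (w t * (-φ t)) * exp (-y * φ t))
    (s := Ioi (x/2)) (bound := fun t => exp ((c+1) * t) * exp (-(x/2) * sinh t))
    (Ioi_mem_nhds (by linarith)) ?_ ?_ ?_ ?_ ?_ ?_).2
  · exact Eventually.of_forall fun y => (by fun_prop : Continuous fun t => w t * exp (-y * φ t)).aestronglyMeasurable
  · refine integrable_of_bound c (x/2) (by linarith) (by fun_prop) fun t ht => ?_
    rw [norm_mul, Real.norm_eq_abs, Real.norm_eq_abs, abs_exp]
    exact mul_le_mul (hwb t ht) (key x t ht (by linarith)) (exp_pos _).le (exp_pos _).le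
  · exact (by fun_prop : Continuous fun t => (w t * (-φ t)) * exp (-x * φ t)).aestronglyMeasurable
  · refine (ae_restrict_iff' measurableSet_Ioi).2 (Eventually.of_forall fun t ht y hy => ?_)
    rw [norm_mul, Real.norm_eq_abs, Real.norm_eq_abs, abs_exp]
    exact mul_le_mul (wb t ht) (key y t ht (le_of_lt hy)) (exp_pos _).le (exp_pos _).le
  · refine integrable_of_bound (c+1) (x/2) (by linarith) (by fun_prop) fun t ht => ?_
    rw [Real.norm_eq_abs, abs_of_pos (by positivity)]
  · refine Eventually.of_forall fun t y hy => ?_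
    have : HasDerivAt (fun y : ℝ => -y * φ t) (-φ t) y := by
      simpa using ((hasDerivAt_id y).neg).mul_const (φ t)
    exact (this.exp.const_mul (w t)).congr_deriv (by ring)

end BesselAux

open Real Set Filter Topology MeasureTheory

namespace BesselAux

/-- arc part of the Hankel contour for the reciprocal Gamma function -/
noncomputable def arcA (ν R : ℝ) : ℝ := ∫ θ in (0:ℝ)..π, exp (R * cos θ) * cos (R * sin θ - ν * θ)
/-- ray part of the Hankel contour for the reciprocal Gamma function -/
noncomputable def rayA (ν R : ℝ) : ℝ := ∫ t in Ioi (0:ℝ), exp (-ν * t) * exp (-R * exp t)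
/-- the whole Hankel contour integral -/
noncomputable def hankA (ν R : ℝ) : ℝ := arcA ν R - sin (π * ν) * rayA ν R

lemma arcA_deriv (ν R : ℝ) : HasDerivAt (arcA ν) (arcA (ν - 1) R) R := by
  refine hasDerivAt_param (F := fun R θ => exp (R * cos θ) * cos (R * sin θ - ν * θ))
    (F' := fun R θ => exp (R * cos θ) * cos (R * sin θ - (ν - 1) * θ)) 0 π R ?_ ?_ ?_
  · simp only [Function.uncurry_def]; fun_prop
  · simp only [Function.uncurry_def]; fun_prop
  · intro y t
    have h1 : HasDerivAt (fun y : ℝ => y * cos t) (cos t) y := by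
      simpa using (hasDerivAt_id y).mul_const (cos t)
    have h2 : HasDerivAt (fun y : ℝ => y * sin t - ν * t) (sin t) y := by
      simpa using ((hasDerivAt_id y).mul_const (sin t)).sub_const (ν * t)
    refine (h1.exp.mul h2.cos).congr_deriv ?_
    have : y * sin t - (ν - 1) * t = (y * sin t - ν * t) + t := by ring
    rw [this, cos_add]; ring

lemma rayA_deriv (ν : ℝ) {R : ℝ} (hR : 0 < R) : HasDerivAt (rayA ν) (-rayA (ν - 1) R) R := by
  refine (hasDerivAt_ray (w := fun t => exp (-ν * t)) (φ := exp) (-ν) (by fun_prop) (by fun_prop)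
    (fun t _ => by rw [abs_exp]) (fun t _ => sinh_le_exp' t) (fun t _ => le_rfl) hR).congr_deriv ?_
  rw [rayA, ← integral_neg]
  congr 1; ext t
  have : exp (-(ν - 1) * t) = exp (-ν * t) * exp t := by rw [← exp_add]; congr 1; ring
  rw [this]; ring

lemma rayA_integrable (ν : ℝ) {R : ℝ} (hR : 0 < R) :
    IntegrableOn (fun t => exp (-ν * t) * exp (-R * exp t)) (Ioi 0) := by
  refine integrable_of_bound (-ν) R hR (by fun_prop) fun t ht => ?_
  rw [Real.norm_eq_abs, abs_of_pos (by positivity)]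
  have := sinh_le_exp' t
  exact mul_le_mul_of_nonneg_left (exp_le_exp.2 (by nlinarith)) (exp_pos _).le

lemma arcA_rec (ν R : ℝ) : R * arcA (ν - 1) R = ν * arcA ν R - exp (-R) * sin (π * ν) := by
  have h : ∫ θ in (0:ℝ)..π, (R * (exp (R * cos θ) * cos (R * sin θ - (ν - 1) * θ))
      - ν * (exp (R * cos θ) * cos (R * sin θ - ν * θ))) =
      exp (R * cos π) * sin (R * sin π - ν * π) - exp (R * cos 0) * sin (R * sin 0 - ν * 0) := by
    refine intervalIntegral.integral_eq_sub_of_hasDerivAt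
      (f := fun θ => exp (R * cos θ) * sin (R * sin θ - ν * θ)) ?_ ?_
    · intro t _
      have h1 : HasDerivAt (fun y : ℝ => R * cos y) (R * (-sin t)) t := (hasDerivAt_cos t).const_mul R
      have h2 : HasDerivAt (fun y : ℝ => R * sin y - ν * y) (R * cos t - ν) t := by
        simpa using ((hasDerivAt_sin t).const_mul R).fun_sub ((hasDerivAt_id t).const_mul ν)
      refine (h1.exp.mul h2.sin).congr_deriv ?_
      have : R * sin t - (ν - 1) * t = (R * sin t - ν * t) + t := by ring
      rw [this, cos_add]; ring
    · exact Continuous.intervalIntegrable (by fun_prop) _ _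
  rw [intervalIntegral.integral_sub (Continuous.intervalIntegrable (by fun_prop) _ _)
    (Continuous.intervalIntegrable (by fun_prop) _ _), intervalIntegral.integral_const_mul,
    intervalIntegral.integral_const_mul] at h
  simp only [cos_pi, sin_pi, mul_zero, zero_sub, cos_zero, sin_zero, sub_zero] at h
  rw [sin_neg, mul_comm ν π, mul_neg, mul_neg_one] at h
  unfold arcA
  linarith

lemma tendsto_exp_sinh (c ε : ℝ) (hε : 0 < ε) {g : ℝ → ℝ}
    (hg : ∀ t, 0 < t → |g t| ≤ exp (c * t) * exp (-ε * sinh t)) : Tendsto g atTop (𝓝 0) := by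
  have h0 : Tendsto (fun t : ℝ => exp ((c + 1) ^ 2 / ε) * exp (-t)) atTop (𝓝 0) := by
    simpa using (tendsto_exp_neg_atTop_nhds_zero).const_mul (exp ((c + 1) ^ 2 / ε))
  refine squeeze_zero_norm' ?_ h0
  filter_upwards [eventually_gt_atTop 0] with t ht
  exact (hg t ht).trans (exp_sinh_bound c ε t hε ht.le)

lemma rayA_rec (ν : ℝ) {R : ℝ} (hR : 0 < R) : R * rayA (ν - 1) R = exp (-R) - ν * rayA ν R := by
  have i1 := (rayA_integrable (ν - 1) hR).const_mul R
  have i2 := (rayA_integrable ν hR).const_mul ν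
  have h := integral_Ioi_of_hasDerivAt_of_tendsto' (a := (0:ℝ)) (m := 0)
    (f := fun t => exp (-ν * t) * exp (-R * exp t))
    (f' := fun t => -(R * (exp (-(ν - 1) * t) * exp (-R * exp t)) +
      ν * (exp (-ν * t) * exp (-R * exp t)))) ?_ (i1.add i2).neg ?_
  · rw [integral_neg, integral_add i1 i2, integral_const_mul, integral_const_mul] at h
    simp only [mul_zero, exp_zero, one_mul, mul_one] at h
    unfold rayA; linarith
  · intro t _
    have h1 : HasDerivAt (fun y : ℝ => -ν * y) (-ν) t := by
      simpa using (hasDerivAt_id t).const_mul (-ν)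
    have h2 := (Real.hasDerivAt_exp t).const_mul (-R)
    refine (h1.exp.mul h2.exp).congr_deriv ?_
    have : exp (-(ν - 1) * t) = exp (-ν * t) * exp t := by rw [← exp_add]; congr 1; ring
    rw [this]; ring
  · refine tendsto_exp_sinh (-ν) R hR fun t ht => ?_
    rw [abs_of_pos (by positivity)]
    have := sinh_le_exp' t
    exact mul_le_mul_of_nonneg_left (exp_le_exp.2 (by nlinarith)) (exp_pos _).le

lemma hankA_rec (ν : ℝ) {R : ℝ} (hR : 0 < R) : R * hankA (ν - 1) R = ν * hankA ν R := by
  have h1 := arcA_rec ν R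
  have h2 := rayA_rec ν hR
  have h3 : sin (π * (ν - 1)) = - sin (π * ν) := by
    rw [mul_sub, mul_one, sin_sub_pi]
  unfold hankA
  rw [h3]
  linear_combination h1 + sin (π * ν) * h2

lemma hankA_deriv (ν : ℝ) {R : ℝ} (hR : 0 < R) : HasDerivAt (hankA ν) (hankA (ν - 1) R) R := by
  refine ((arcA_deriv ν R).sub ((rayA_deriv ν hR).const_mul (sin (π * ν)))).congr_deriv ?_
  have h3 : sin (π * (ν - 1)) = - sin (π * ν) := by
    rw [mul_sub, mul_one, sin_sub_pi]
  unfold hankA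
  rw [h3]; ring

lemma hankA_const (ν : ℝ) {R S : ℝ} (hR : 0 < R) (hS : 0 < S) :
    hankA ν R * R ^ (-ν) = hankA ν S * S ^ (-ν) := by
  have hd : ∀ y ∈ Ioi (0:ℝ), HasDerivAt (fun y => hankA ν y * y ^ (-ν)) 0 y := by
    intro y hy
    have hy' : (0:ℝ) < y := hy
    refine ((hankA_deriv ν hy').mul (Real.hasDerivAt_rpow_const (p := -ν) (Or.inl hy'.ne'))).congr_deriv ?_
    have h := hankA_rec ν hy'
    rw [Real.rpow_sub_one hy'.ne']
    field_simp
    linear_combination (y ^ (-ν)) * h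
  exact IsOpen.is_const_of_deriv_eq_zero isOpen_Ioi (convex_Ioi 0).isPreconnected
    (fun y hy => (hd y hy).differentiableAt.differentiableWithinAt)
    (fun y hy => (hd y hy).deriv) hR hS

lemma rayA_subst (ν : ℝ) {R : ℝ} (hR : 0 < R) :
    rayA ν R * R ^ (-ν) = ∫ u in Ioi R, exp (-u) * u ^ (-ν - 1) := by
  have him : (fun t => R * exp t) '' Ioi 0 = Ioi R := by
    ext u
    simp only [mem_image, mem_Ioi]
    constructor
    · rintro ⟨t, ht, rfl⟩
      have := Real.one_lt_exp_iff.2 ht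
      nlinarith
    · intro hu
      refine ⟨log (u / R), Real.log_pos (by rw [lt_div_iff₀ hR]; linarith), ?_⟩
      rw [Real.exp_log (div_pos (hR.trans hu) hR)]; field_simp
  rw [← him, integral_image_eq_integral_abs_deriv_smul (f' := fun t => R * exp t) measurableSet_Ioi
    (fun t _ => ((Real.hasDerivAt_exp t).const_mul R).hasDerivWithinAt)
    (fun a _ b _ h => by simpa [hR.ne'] using h), rayA, ← integral_mul_const]
  congr 1; ext t
  have hp : 0 < R * exp t := by positivity
  rw [abs_of_pos hp, smul_eq_mul, Real.rpow_sub_one hp.ne', Real.mul_rpow hR.le (exp_pos t).le,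
    ← Real.exp_mul]
  field_simp

lemma hankA_zero {R : ℝ} (hR : 0 < R) : hankA 0 R = π := by
  have h : ∀ S, 0 < S → arcA 0 S = hankA 0 R := by
    intro S hS
    have := hankA_const 0 hR hS
    simp only [neg_zero, rpow_zero, mul_one] at this
    rw [this]; simp [hankA]
  have hc : Tendsto (arcA 0) (𝓝[>] 0) (𝓝 (arcA 0 0)) :=
    (arcA_deriv 0 0).continuousAt.tendsto.mono_left nhdsWithin_le_nhds
  have hc2 : Tendsto (arcA 0) (𝓝[>] 0) (𝓝 (hankA 0 R)) := by
    refine tendsto_const_nhds.congr' ?_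
    filter_upwards [self_mem_nhdsWithin] with S hS using (h S hS).symm
  rw [tendsto_nhds_unique hc2 hc]
  simp [arcA]

lemma hankA_neg {ν R : ℝ} (h0 : ν < 0) (h1 : -1 < ν) (hR : 0 < R) :
    hankA ν R = π * R ^ ν / Gamma (ν + 1) := by
  have hi : IntegrableOn (fun u => exp (-u) * u ^ (-ν - 1)) (Ioi 0) := by
    exact Real.GammaIntegral_convergent (by linarith)
  set S : ℕ → ℝ := fun n => 1 / ((n:ℝ) + 1)
  have hS : ∀ n, 0 < S n := fun n => by positivity
  have hSt : Tendsto S atTop (𝓝 0) := tendsto_one_div_add_atTop_nhds_zero_nat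
  have hU : ⋃ n, Ioi (S n) = Ioi 0 := by
    ext u
    simp only [mem_iUnion, mem_Ioi]
    constructor
    · rintro ⟨n, hn⟩; exact (hS n).trans hn
    · intro hu
      exact ((hSt.eventually (gt_mem_nhds hu)).exists)
  have t1 : Tendsto (fun n => ∫ u in Ioi (S n), exp (-u) * u ^ (-ν - 1)) atTop
      (𝓝 (Gamma (-ν))) := by
    rw [Real.Gamma_eq_integral (by linarith), ← hU]
    refine tendsto_setIntegral_of_monotone (fun n => measurableSet_Ioi) ?_ (by rw [hU]; exact hi)
    intro n m hnm
    refine Ioi_subset_Ioi ?_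
    exact one_div_le_one_div_of_le (by positivity) (by gcongr)
  have t2 : Tendsto (fun n => arcA ν (S n) * (S n) ^ (-ν)) atTop (𝓝 0) := by
    have a1 : Tendsto (fun n => arcA ν (S n)) atTop (𝓝 (arcA ν 0)) :=
      (arcA_deriv ν 0).continuousAt.tendsto.comp hSt
    have a2 : Tendsto (fun n => (S n) ^ (-ν)) atTop (𝓝 ((0:ℝ) ^ (-ν))) :=
      ((Real.continuousAt_rpow_const 0 (-ν) (Or.inr (by linarith))).tendsto).comp hSt
    rw [Real.zero_rpow (by linarith)] at a2
    simpa using a1.mul a2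
  have t3 : Tendsto (fun _ : ℕ => hankA ν R * R ^ (-ν)) atTop (𝓝 (0 - sin (π * ν) * Gamma (-ν))) := by
    refine (t2.sub (t1.const_mul (sin (π * ν)))).congr fun n => ?_
    rw [hankA_const ν hR (hS n), ← rayA_subst ν (hS n), hankA]; ring
  have h4 := tendsto_nhds_unique tendsto_const_nhds t3
  have h5 := Real.Gamma_mul_Gamma_one_sub (-ν)
  have hs : sin (π * ν) ≠ 0 := by
    have : 0 < sin (-(π * ν)) := sin_pos_of_pos_of_lt_pi (by nlinarith [pi_pos]) (by nlinarith [pi_pos])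
    rw [sin_neg] at this; linarith
  have hG : Gamma (ν + 1) ≠ 0 := (Real.Gamma_pos_of_pos (by linarith)).ne'
  rw [show 1 - -ν = ν + 1 by ring, mul_neg, sin_neg] at h5
  have hR' : R ^ (-ν) * R ^ ν = 1 := by rw [← Real.rpow_add hR]; simp
  rw [div_neg] at h5
  have h6 : Gamma (-ν) * Gamma (ν + 1) * sin (π * ν) = -π := by
    rw [h5, neg_mul, div_mul_cancel₀ _ hs]
  rw [eq_div_iff hG]
  linear_combination (R ^ ν * Gamma (ν+1)) * h4 - (hankA ν R * Gamma (ν+1)) * hR' - (R ^ ν) * h6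

lemma hankA_eq {R : ℝ} (hR : 0 < R) (n : ℕ) : ∀ ν : ℝ, -1 < ν → ν ≤ n →
    hankA ν R = π * R ^ ν / Gamma (ν + 1) := by
  induction n with
  | zero =>
    intro ν h1 h2
    rcases lt_or_eq_of_le h2 with h | h
    · exact hankA_neg (by simpa using h) h1 hR
    · have : ν = 0 := by simpa using h
      subst this
      simp [hankA_zero hR]
  | succ n ih =>
    intro ν h1 h2
    push_cast at h2
    rcases le_or_gt ν 0 with h | h
    · exact ih ν h1 (h.trans (Nat.cast_nonneg n))
    · have h3 := ih (ν - 1) (by linarith) (by linarith)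
      have h4 := hankA_rec ν hR
      rw [h3, sub_add_cancel] at h4
      have h5 : Gamma (ν + 1) = ν * Gamma ν := Real.Gamma_add_one h.ne'
      have hG : Gamma ν ≠ 0 := (Real.Gamma_pos_of_pos h).ne'
      rw [h5]
      rw [Real.rpow_sub_one hR.ne'] at h4
      field_simp at h4 ⊢
      linarith

end BesselAux

open Real Set Filter Topology MeasureTheory

namespace BesselAux

lemma hasSum_exp_real (y : ℝ) : HasSum (fun k : ℕ => y ^ k / (k.factorial : ℝ)) (exp y) := by
  rw [Real.exp_eq_exp_ℝ]; exact NormedSpace.expSeries_div_hasSum_exp y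

lemma hasSum_exp_cplx (y : ℂ) : HasSum (fun k : ℕ => y ^ k / (k.factorial : ℂ)) (Complex.exp y) := by
  rw [Complex.exp_eq_exp_ℂ]; exact NormedSpace.expSeries_div_hasSum_exp y

lemma arc_pointwise (ν R θ : ℝ) :
    HasSum (fun k : ℕ => ((-R) ^ k / (k.factorial : ℝ)) *
      (exp (R * cos θ) * cos (R * sin θ - (k + ν) * θ))) (cos (2 * R * sin θ - ν * θ)) := by
  have h := (hasSum_exp_cplx (-R * Complex.exp (-(θ * Complex.I)))).mul_right
    (Complex.exp (R * Complex.exp (θ * Complex.I) - ν * θ * Complex.I))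
  have h2 := Complex.hasSum_re h
  have e : ∀ a b : ℝ, (Complex.exp (a + b * Complex.I)).re = exp a * cos b := by
    intro a b; rw [Complex.exp_re]; simp
  have c1 : Complex.exp (θ * Complex.I) = cos θ + sin θ * Complex.I := by
    rw [Complex.exp_mul_I]; push_cast; rfl
  have c2 : Complex.exp (-(θ * Complex.I)) = cos θ - sin θ * Complex.I := by
    rw [← neg_mul, Complex.exp_mul_I]; push_cast; simp [Complex.cos_neg, Complex.sin_neg]; ring
  convert h2 using 1
  · ext k
    have : (-R * Complex.exp (-(θ * Complex.I))) ^ k / (k.factorial : ℂ) *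
        Complex.exp (R * Complex.exp (θ * Complex.I) - ν * θ * Complex.I) =
        (((-R) ^ k / (k.factorial : ℝ) : ℝ) : ℂ) *
        Complex.exp (((R * cos θ : ℝ) : ℂ) + ((R * sin θ - (k + ν) * θ : ℝ) : ℂ) * Complex.I) := by
      rw [mul_pow, ← Complex.exp_nat_mul, c1]
      have : Complex.exp (((R * cos θ : ℝ) : ℂ) + ((R * sin θ - (k + ν) * θ : ℝ) : ℂ) * Complex.I)
         = Complex.exp (k * -(θ * Complex.I)) *
           Complex.exp (R * (cos θ + sin θ * Complex.I) - ν * θ * Complex.I) := by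
        rw [← Complex.exp_add]; congr 1; push_cast; ring
      rw [this]; push_cast; ring
    rw [this, Complex.re_ofReal_mul, e]
  · rw [← Complex.exp_add]
    have : -R * Complex.exp (-(θ * Complex.I)) + (R * Complex.exp (θ * Complex.I) - ν * θ * Complex.I)
      = ((0:ℝ):ℂ) + ((2 * R * sin θ - ν * θ : ℝ) : ℂ) * Complex.I := by
      rw [c1, c2]; push_cast; ring
    rw [this, e]; simp

lemma arc_sum (ν : ℝ) {R : ℝ} (hR : 0 < R) :
    HasSum (fun k : ℕ => ((-R) ^ k / (k.factorial : ℝ)) * arcA (k + ν) R)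
      (∫ θ in (0:ℝ)..π, cos (2 * R * sin θ - ν * θ)) := by
  have hs := hasSum_exp_real R
  have := intervalIntegral.hasSum_integral_of_dominated_convergence (μ := volume) (a := 0) (b := π)
    (F := fun (k : ℕ) θ => ((-R) ^ k / (k.factorial : ℝ)) *
      (exp (R * cos θ) * cos (R * sin θ - (k + ν) * θ)))
    (f := fun θ => cos (2 * R * sin θ - ν * θ)) (fun k _ => R ^ k / (k.factorial : ℝ) * exp R)
    ?_ ?_ ?_ ?_ ?_
  · refine this.congr_fun fun k => ?_
    rw [intervalIntegral.integral_const_mul]; rfl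
  · intro k; exact (by fun_prop : Continuous _).aestronglyMeasurable
  · intro k
    refine Eventually.of_forall fun θ _ => ?_
    rw [norm_mul, norm_mul, norm_div, norm_pow, norm_neg, Real.norm_of_nonneg hR.le,
      Real.norm_of_nonneg (exp_pos _).le, Real.norm_of_nonneg (by positivity : (0:ℝ) ≤ k.factorial)]
    gcongr
    calc exp (R * cos θ) * ‖cos (R * sin θ - (k + ν) * θ)‖ ≤ exp R * 1 := by
          gcongr
          · nlinarith [cos_le_one θ]
          · exact abs_cos_le_one _
      _ = exp R := mul_one _
  · exact Eventually.of_forall fun θ _ => (hs.mul_right _).summable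
  · exact intervalIntegrable_const
  · exact Eventually.of_forall fun θ _ => arc_pointwise ν R θ

lemma ray_sum (ν : ℝ) {R : ℝ} (hR : 0 < R) :
    HasSum (fun k : ℕ => (R ^ k / (k.factorial : ℝ)) * rayA (k + ν) R)
      (∫ t in Ioi (0:ℝ), exp (-ν * t) * exp (-(2 * R) * sinh t)) := by
  have hs := hasSum_exp_real R
  have := hasSum_integral_of_dominated_convergence (μ := volume.restrict (Ioi (0:ℝ)))
    (F := fun (k : ℕ) t => (R ^ k / (k.factorial : ℝ)) * (exp (-(k + ν) * t) * exp (-R * exp t)))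
    (f := fun t => exp (-ν * t) * exp (-(2 * R) * sinh t))
    (fun k t => R ^ k / (k.factorial : ℝ) * (exp (-ν * t) * exp (-R * exp t)))
    ?_ ?_ ?_ ?_ ?_
  · refine this.congr_fun fun k => ?_
    rw [integral_const_mul]; rfl
  · intro k; exact (by fun_prop : Continuous _).aestronglyMeasurable
  · intro k
    refine (ae_restrict_iff' measurableSet_Ioi).2 (Eventually.of_forall fun t ht => ?_)
    have ht' : (0:ℝ) < t := ht
    rw [Real.norm_of_nonneg (by positivity)]
    have : exp (-(k + ν) * t) ≤ exp (-ν * t) := by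
      rw [exp_le_exp]; nlinarith [mul_nonneg (Nat.cast_nonneg (α := ℝ) k) ht'.le]
    gcongr
  · exact Eventually.of_forall fun t => (hs.mul_right _).summable
  · have : ∀ t : ℝ, ∑' k : ℕ, R ^ k / (k.factorial : ℝ) * (exp (-ν * t) * exp (-R * exp t)) =
      exp R * (exp (-ν * t) * exp (-R * exp t)) := fun t => (hs.mul_right _).tsum_eq
    simp_rw [this]
    exact (rayA_integrable ν hR).const_mul _
  · refine Eventually.of_forall fun t => ?_
    have h := (hasSum_exp_real (R * exp (-t))).mul_right (exp (-ν * t) * exp (-R * exp t))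
    have e2 : exp (-ν * t) * exp (-(2 * R) * sinh t) =
        exp (R * exp (-t)) * (exp (-ν * t) * exp (-R * exp t)) := by
      rw [← exp_add, ← exp_add, ← exp_add, Real.sinh_eq]; congr 1; ring
    rw [e2]
    refine h.congr_fun fun k => ?_
    have : exp (-(k + ν) * t) = exp (-t) ^ k * exp (-ν * t) := by
      rw [← Real.exp_nat_mul, ← exp_add]; congr 1; ring
    rw [this, mul_pow]; ring

lemma besselJ_eq {ν x : ℝ} (hν : 0 ≤ ν) (hx : 0 < x) :
    besselJ ν x = (1 / π) * (∫ θ in (0:ℝ)..π, cos (x * sin θ - ν * θ))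
      - (1 / π) * (sin (π * ν) * ∫ t in Ioi (0:ℝ), exp (-ν * t) * exp (-x * sinh t)) := by
  have hR : 0 < x / 2 := by linarith
  have h := ((arc_sum ν hR).mul_left (1 / π)).sub
    (((ray_sum ν hR).mul_left (sin (π * ν))).mul_left (1 / π))
  rw [show 2 * (x / 2) = x by ring] at h
  rw [besselJ, ← h.tsum_eq]
  congr 1; ext k
  have hk : (k : ℝ) + ν ≤ ((k + ⌈ν⌉₊ : ℕ) : ℝ) := by push_cast; linarith [Nat.le_ceil ν]
  have hA := hankA_eq hR _ ((k:ℝ) + ν) (by have := Nat.cast_nonneg (α := ℝ) k; linarith) hk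
  have hs : sin (π * (k + ν)) = (-1) ^ k * sin (π * ν) := by
    rw [mul_add, add_comm, mul_comm π (k:ℝ), sin_add_nat_mul_pi]
  rw [hankA, hs, Real.rpow_add hR, Real.rpow_natCast] at hA
  have h1 : ((-1 : ℝ) ^ k) * (-1) ^ k = 1 := by rw [← mul_pow]; simp
  have hG : Gamma ((k:ℝ) + ν + 1) ≠ 0 :=
    (Real.Gamma_pos_of_pos (by have := Nat.cast_nonneg (α := ℝ) k; linarith)).ne'
  have h2 : (-(x/2)) ^ k = (-1) ^ k * (x/2) ^ k := by rw [← mul_pow]; ring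
  rw [h2]
  have hk0 : (k.factorial : ℝ) ≠ 0 := by positivity
  have e1 : (-1) ^ k / (k.factorial * Gamma ((k:ℝ) + ν + 1)) * (x/2)^(2*k) * (x/2)^ν
     = 1 / π * ((-1) ^ k * (x/2) ^ k / k.factorial * (π * ((x/2)^k * (x/2)^ν) / Gamma (k + ν + 1))) := by
    rw [two_mul, pow_add]; field_simp
  rw [e1, ← hA]
  linear_combination (-(1 / π) * (x/2)^k / k.factorial * sin (π * ν) * rayA (k + ν) (x/2)) * h1

end BesselAux

open Real Set Filter Topology MeasureTheory

namespace BesselAux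

/-- arc part of the Schläfli–Sommerfeld integral, with `j` derivatives -/
noncomputable def arcH (ν : ℝ) (j : ℕ) (x : ℝ) : ℂ :=
  ∫ θ in (0:ℝ)..π, (Complex.I * sin θ) ^ j * Complex.exp (Complex.I * (x * sin θ - ν * θ))
/-- ray part of the Schläfli–Sommerfeld integral, with `j` derivatives -/
noncomputable def rayH (ν : ℝ) (j : ℕ) (x : ℝ) : ℝ :=
  ∫ t in Ioi (0:ℝ), (exp (ν * t) * (-sinh t) ^ j) * exp (-x * sinh t)
/-- the Hankel function and its derivatives -/
noncomputable def HH (ν : ℝ) (j : ℕ) (x : ℝ) : ℂ :=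
  (1 / π : ℂ) * (arcH ν j x - Complex.I * rayH ν j x
    - Complex.I * Complex.exp (-(Complex.I * (ν * π))) * rayH (-ν) j x)

lemma arcH_deriv (ν : ℝ) (j : ℕ) (x : ℝ) : HasDerivAt (arcH ν j) (arcH ν (j+1) x) x := by
  refine hasDerivAt_param
    (F := fun x θ => (Complex.I * sin θ) ^ j * Complex.exp (Complex.I * (x * sin θ - ν * θ)))
    (F' := fun x θ => (Complex.I * sin θ) ^ (j+1) * Complex.exp (Complex.I * (x * sin θ - ν * θ)))
    0 π x ?_ ?_ ?_
  · simp only [Function.uncurry_def]; fun_prop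
  · simp only [Function.uncurry_def]; fun_prop
  · intro y t
    have h1 : HasDerivAt (fun y : ℝ => Complex.I * ((y:ℂ) * sin t - ν * t)) (Complex.I * sin t) y := by
      have := ((((hasDerivAt_id y).ofReal_comp).mul_const (sin t : ℂ)).sub_const ((ν:ℂ) * t)).const_mul Complex.I
      simpa using this
    refine (h1.cexp.const_mul _).congr_deriv ?_
    ring

lemma abs_sinh_pow_le (ν : ℝ) (j : ℕ) (t : ℝ) (ht : 0 < t) :
    |exp (ν * t) * (-sinh t) ^ j| ≤ exp ((ν + j) * t) := by
  have h2 : 0 < sinh t := Real.sinh_pos_iff.2 ht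
  rw [abs_mul, abs_exp, abs_pow, abs_neg, abs_of_pos h2, add_mul, exp_add, Real.exp_nat_mul]
  gcongr
  exact sinh_le_exp' t

lemma rayH_deriv (ν : ℝ) (j : ℕ) {x : ℝ} (hx : 0 < x) :
    HasDerivAt (rayH ν j) (rayH ν (j+1) x) x := by
  refine (hasDerivAt_ray (w := fun t => exp (ν * t) * (-sinh t) ^ j) (φ := sinh) (ν + j)
    (by fun_prop) (by fun_prop) (abs_sinh_pow_le ν j)
    (fun t _ => le_rfl) (fun t _ => sinh_le_exp' t) hx).congr_deriv ?_
  rw [rayH]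
  congr 1; ext t
  ring

lemma rayH_integrable (ν : ℝ) (j : ℕ) {x : ℝ} (hx : 0 < x) :
    IntegrableOn (fun t => (exp (ν * t) * (-sinh t) ^ j) * exp (-x * sinh t)) (Ioi 0) := by
  refine integrable_of_bound (ν + j) x hx (by fun_prop) fun t ht => ?_
  rw [norm_mul, Real.norm_eq_abs, Real.norm_eq_abs, abs_exp]
  gcongr
  exact abs_sinh_pow_le ν j t ht

lemma HH_deriv (ν : ℝ) (j : ℕ) {x : ℝ} (hx : 0 < x) : HasDerivAt (HH ν j) (HH ν (j+1) x) x := by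
  exact (((arcH_deriv ν j x).sub ((rayH_deriv ν j hx).ofReal_comp.const_mul Complex.I)).sub
    ((rayH_deriv (-ν) j hx).ofReal_comp.const_mul _)).const_mul _

lemma rayH_ode (ν : ℝ) {x : ℝ} (hx : 0 < x) :
    x ^ 2 * rayH ν 2 x + x * rayH ν 1 x + (x ^ 2 - ν ^ 2) * rayH ν 0 x = x + ν := by
  have i2 := (rayH_integrable ν 2 hx).const_mul (x^2)
  have i1 := (rayH_integrable ν 1 hx).const_mul x
  have i0 := (rayH_integrable ν 0 hx).const_mul (x^2 - ν^2)
  have h := integral_Ioi_of_hasDerivAt_of_tendsto' (a := (0:ℝ)) (m := 0)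
    (f := fun t => -(x * cosh t + ν) * (exp (ν * t) * exp (-x * sinh t)))
    (f' := fun t => x^2 * ((exp (ν * t) * (-sinh t) ^ 2) * exp (-x * sinh t))
      + x * ((exp (ν * t) * (-sinh t) ^ 1) * exp (-x * sinh t))
      + (x^2 - ν^2) * ((exp (ν * t) * (-sinh t) ^ 0) * exp (-x * sinh t))) ?_ ((i2.fun_add i1).fun_add i0) ?_
  · rw [integral_add (i2.fun_add i1) i0, integral_add i2 i1, integral_const_mul, integral_const_mul,
      integral_const_mul] at h
    simp only [mul_zero, exp_zero, mul_one, cosh_zero, sinh_zero] at h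
    unfold rayH; linarith
  · intro t _
    have h1 : HasDerivAt (fun y : ℝ => ν * y) ν t := by
      simpa using (hasDerivAt_id t).const_mul ν
    have h2 := (Real.hasDerivAt_sinh t).const_mul (-x)
    have h3 := (((Real.hasDerivAt_cosh t).const_mul x).add_const ν).neg
    refine (h3.mul (h1.exp.mul h2.exp)).congr_deriv ?_
    simp only [Pi.mul_apply, Pi.neg_apply]
    have := Real.cosh_sq t
    linear_combination (x^2 * exp (ν * t) * exp (-x * sinh t)) * this
  · have e1 : Tendsto (fun t => exp (ν * t) * cosh t * exp (-x * sinh t)) atTop (𝓝 0) := by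
      refine tendsto_exp_sinh (ν + 1) x hx fun t ht => ?_
      rw [abs_of_pos (by have := cosh_pos t; positivity), add_mul, exp_add, one_mul]
      have : cosh t ≤ exp t := by
        rw [Real.cosh_eq]
        have : exp (-t) ≤ exp t := by rw [exp_le_exp]; linarith
        linarith
      gcongr
    have e2 : Tendsto (fun t => exp (ν * t) * exp (-x * sinh t)) atTop (𝓝 0) := by
      refine tendsto_exp_sinh ν x hx fun t ht => ?_
      rw [abs_of_pos (by positivity)]
    have e3 := (e1.const_mul (-x)).add (e2.const_mul (-ν))
    simp only [mul_zero, add_zero] at e3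
    refine e3.congr fun t => ?_
    ring

lemma arcH_ode (ν x : ℝ) :
    x ^ 2 * arcH ν 2 x + x * arcH ν 1 x + (x ^ 2 - ν ^ 2) * arcH ν 0 x =
      Complex.I * (x + ν) + Complex.I * Complex.exp (-(Complex.I * (ν * π))) * (x - ν) := by
  have h : ∫ θ in (0:ℝ)..π,
      ((x:ℂ)^2 * ((Complex.I * sin θ) ^ 2 * Complex.exp (Complex.I * (x * sin θ - ν * θ)))
      + x * ((Complex.I * sin θ) ^ 1 * Complex.exp (Complex.I * (x * sin θ - ν * θ)))
      + ((x:ℂ)^2 - ν^2) * ((Complex.I * sin θ) ^ 0 * Complex.exp (Complex.I * (x * sin θ - ν * θ)))) =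
      (fun θ : ℝ => -Complex.I * (x * cos θ + ν) * Complex.exp (Complex.I * (x * sin θ - ν * θ))) π -
      (fun θ : ℝ => -Complex.I * (x * cos θ + ν) * Complex.exp (Complex.I * (x * sin θ - ν * θ))) 0 := by
    refine intervalIntegral.integral_eq_sub_of_hasDerivAt (f := fun θ : ℝ =>
      -Complex.I * (x * cos θ + ν) * Complex.exp (Complex.I * (x * sin θ - ν * θ))) ?_ ?_
    · intro t _
      have h1 : HasDerivAt (fun y : ℝ => Complex.I * ((x:ℂ) * sin y - ν * y))
          (Complex.I * (x * cos t - ν)) t := by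
        have := ((((hasDerivAt_sin t).ofReal_comp).const_mul (x:ℂ)).sub
          (((hasDerivAt_id t).ofReal_comp).const_mul (ν:ℂ))).const_mul Complex.I
        simp only [Complex.ofReal_one, mul_one] at this
        exact this
      have h2 := ((((hasDerivAt_cos t).ofReal_comp).const_mul (x:ℂ)).add_const (ν:ℂ)).const_mul
        (-Complex.I)
      refine (h2.mul h1.cexp).congr_deriv ?_
      have hs : ((sin t : ℝ) : ℂ) ^ 2 + ((cos t : ℝ) : ℂ) ^ 2 = 1 := by
        rw [← Complex.ofReal_pow, ← Complex.ofReal_pow, ← Complex.ofReal_add, sin_sq_add_cos_sq]; simp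
      have hI := Complex.I_sq
      simp only [Complex.ofReal_neg]
      set E := Complex.exp (Complex.I * (x * sin t - ν * t))
      set s := ((sin t : ℝ) : ℂ)
      set c := ((cos t : ℝ) : ℂ)
      linear_combination (-(x:ℂ)^2 * c^2 + ν^2 - x^2 * s^2) * E * hI + (x:ℂ)^2 * E * hs
    · exact Continuous.intervalIntegrable (by fun_prop) _ _
  rw [intervalIntegral.integral_add (Continuous.intervalIntegrable (by fun_prop) _ _)
    (Continuous.intervalIntegrable (by fun_prop) _ _),
    intervalIntegral.integral_add (Continuous.intervalIntegrable (by fun_prop) _ _)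
    (Continuous.intervalIntegrable (by fun_prop) _ _), intervalIntegral.integral_const_mul,
    intervalIntegral.integral_const_mul, intervalIntegral.integral_const_mul] at h
  unfold arcH
  rw [h]
  simp
  ring

lemma HH_ode (ν : ℝ) {x : ℝ} (hx : 0 < x) :
    x ^ 2 * HH ν 2 x + x * HH ν 1 x + (x ^ 2 - ν ^ 2) * HH ν 0 x = 0 := by
  have h1 := arcH_ode ν x
  have h2 := congrArg (fun r : ℝ => (r : ℂ)) (rayH_ode ν hx)
  have h3 := congrArg (fun r : ℝ => (r : ℂ)) (rayH_ode (-ν) hx)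
  push_cast at h2 h3
  unfold HH
  linear_combination (1 / π : ℂ) * (h1 - Complex.I * h2
    - Complex.I * Complex.exp (-(Complex.I * (ν * π))) * h3)

lemma arcH_re_im (ν x : ℝ) : (arcH ν 0 x).re = ∫ θ in (0:ℝ)..π, cos (x * sin θ - ν * θ) ∧
    (arcH ν 0 x).im = ∫ θ in (0:ℝ)..π, sin (x * sin θ - ν * θ) := by
  have hc : arcH ν 0 x = ((∫ θ in (0:ℝ)..π, cos (x * sin θ - ν * θ) : ℝ) : ℂ) +
      ((∫ θ in (0:ℝ)..π, sin (x * sin θ - ν * θ) : ℝ) : ℂ) * Complex.I := by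
    rw [← intervalIntegral.integral_ofReal, ← intervalIntegral.integral_ofReal,
      ← intervalIntegral.integral_mul_const, ← intervalIntegral.integral_add
      (Continuous.intervalIntegrable (by fun_prop) _ _)
      (Continuous.intervalIntegrable (by fun_prop) _ _), arcH]
    congr 1; ext θ
    rw [pow_zero, one_mul, mul_comm Complex.I, Complex.exp_mul_I]
    push_cast; rfl
  rw [hc]; simp

lemma HH_re {ν x : ℝ} (hν : 0 ≤ ν) (hx : 0 < x) : (HH ν 0 x).re = besselJ ν x := by
  rw [besselJ_eq hν hx, ← (arcH_re_im ν x).1, HH]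
  have e : Complex.exp (-(Complex.I * (ν * π))) = (cos (ν * π) : ℂ) - sin (ν * π) * Complex.I := by
    rw [mul_comm, ← neg_mul, Complex.exp_mul_I, Complex.cos_neg, Complex.sin_neg]; push_cast; ring
  have e2 : ((1:ℂ) / π) = ((1 / π : ℝ) : ℂ) := by push_cast; rfl
  rw [e2, Complex.re_ofReal_mul, e, ← mul_sub, mul_comm ν π, ]
  congr 1
  simp [rayH, -Complex.ofReal_sin, -Complex.ofReal_cos, -Complex.ofReal_mul]

lemma HH_im {ν x : ℝ} (hx : 0 < x) : (HH ν 0 x).im = besselY ν x := by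
  have h : ∫ t in Set.Ioi (0:ℝ),
        (Real.exp (ν*t) + Real.exp (-ν*t) * Real.cos (ν*Real.pi)) * Real.exp (-x * Real.sinh t)
      = rayH ν 0 x + cos (ν * π) * rayH (-ν) 0 x := by
    have i1 := rayH_integrable ν 0 hx
    have i2 := (rayH_integrable (-ν) 0 hx).const_mul (cos (ν * π))
    rw [rayH, rayH, ← integral_const_mul, ← integral_add i1 i2]
    congr 1; ext t; ring
  rw [besselY, ← (arcH_re_im ν x).2, HH, h]
  have e : Complex.exp (-(Complex.I * (ν * π))) = (cos (ν * π) : ℂ) - sin (ν * π) * Complex.I := by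
    rw [mul_comm, ← neg_mul, Complex.exp_mul_I, Complex.cos_neg, Complex.sin_neg]; push_cast; ring
  have e2 : ((1:ℂ) / π) = ((1 / π : ℝ) : ℂ) := by push_cast; rfl
  rw [e2, Complex.im_ofReal_mul, e, ← mul_sub]
  congr 1
  simp [ -Complex.ofReal_sin, -Complex.ofReal_cos, -Complex.ofReal_mul]
  ring

end BesselAux

open Real Set Filter Topology MeasureTheory

namespace BesselAux

lemma norm_exp_I (y : ℝ) : ‖Complex.exp (Complex.I * y)‖ = 1 := by
  rw [mul_comm]; exact Complex.norm_exp_ofReal_mul_I y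

/-- non-stationary phase: one integration by parts -/
lemma byparts {g g' : ℝ → ℝ} {K : ℂ → ℂ} {a b : ℝ} (hab : a ≤ b)
    (hg : ∀ t, HasDerivAt g (g' t) t) (hg' : Continuous g')
    (hK : ∀ t ∈ Icc a b, AnalyticAt ℂ K (t : ℂ)) :
    ∃ C : ℝ, ∀ x : ℝ, 0 < x →
      ‖∫ t in a..b, Complex.exp (Complex.I * ((x * g t : ℝ) : ℂ)) * ((g' t : ℂ) * K t)‖ ≤ C / x := by
  have hgc : Continuous g := continuous_iff_continuousAt.2 fun t => (hg t).continuousAt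
  have hKd : ∀ t ∈ Icc a b, HasDerivAt (fun t : ℝ => K t) (deriv K t) t := by
    intro t ht
    exact ((hK t ht).differentiableAt.hasDerivAt).comp_ofReal
  have hKc : ContinuousOn (fun t : ℝ => deriv K (t:ℂ)) (Icc a b) := by
    intro t ht
    refine ContinuousAt.continuousWithinAt ?_
    exact ContinuousAt.comp (f := fun t : ℝ => (t:ℂ)) (hK t ht).deriv.continuousAt
      Complex.continuous_ofReal.continuousAt
  obtain ⟨D, hD⟩ := isCompact_Icc.exists_bound_of_continuousOn hKc
  refine ⟨‖K b‖ + ‖K a‖ + D * |b - a|, fun x hx => ?_⟩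
  have hxI : (Complex.I * (x:ℂ)) ≠ 0 := by simp [hx.ne']
  set v : ℝ → ℂ := fun t => Complex.exp (Complex.I * ((x * g t : ℝ) : ℂ)) / (Complex.I * x) with hv
  have hvn : ∀ t, ‖v t‖ = 1 / x := by
    intro t
    rw [hv]; simp only []
    rw [norm_div, norm_exp_I, norm_mul, Complex.norm_I, one_mul, Complex.norm_real,
      Real.norm_of_nonneg hx.le]
  have hvd : ∀ t, HasDerivAt v (Complex.exp (Complex.I * ((x * g t : ℝ) : ℂ)) * (g' t : ℂ)) t := by
    intro t
    have h1 := ((((hg t).const_mul x).ofReal_comp).const_mul Complex.I).cexp.div_const (Complex.I * (x:ℂ))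
    refine h1.congr_deriv ?_
    have hx0 : (x:ℂ) ≠ 0 := by exact_mod_cast hx.ne'
    push_cast
    field_simp
  have hvc : Continuous v := continuous_iff_continuousAt.2 fun t => (hvd t).continuousAt
  have hib := intervalIntegral.integral_mul_deriv_eq_deriv_mul (a := a) (b := b)
    (u := fun t : ℝ => K t) (u' := fun t : ℝ => deriv K t) (v := v)
    (v' := fun t => Complex.exp (Complex.I * ((x * g t : ℝ) : ℂ)) * (g' t : ℂ))
    (fun t ht => hKd t (by rwa [uIcc_of_le hab] at ht)) (fun t _ => hvd t)
    (ContinuousOn.intervalIntegrable (by rwa [uIcc_of_le hab]))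
    (Continuous.intervalIntegrable (by fun_prop) _ _)
  have e1 : ∫ t in a..b, Complex.exp (Complex.I * ((x * g t : ℝ) : ℂ)) * ((g' t : ℂ) * K t)
      = ∫ t in a..b, K t * (Complex.exp (Complex.I * ((x * g t : ℝ) : ℂ)) * (g' t : ℂ)) := by
    congr 1; ext t; ring
  rw [e1, hib]
  have e2 : ‖∫ t in a..b, deriv K t * v t‖ ≤ (D / x) * |b - a| := by
    refine intervalIntegral.norm_integral_le_of_norm_le_const fun t ht => ?_
    rw [uIoc_of_le hab] at ht
    rw [norm_mul, hvn]
    have := hD t ⟨ht.1.le, ht.2⟩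
    rw [div_eq_mul_one_div D x]
    gcongr
  calc _ ≤ ‖K b * v b‖ + ‖K a * v a‖ + ‖∫ t in a..b, deriv K t * v t‖ :=
        (norm_sub_le _ _).trans (by gcongr; exact norm_sub_le _ _)
    _ ≤ ‖K b‖ * (1/x) + ‖K a‖ * (1/x) + (D / x) * |b - a| := by
        rw [norm_mul, norm_mul, hvn, hvn]; gcongr
    _ = _ := by ring

/-- Fresnel type integral -/
noncomputable def fres (x : ℝ) : ℂ := ∫ s in (0:ℝ)..1, Complex.exp (Complex.I * ((x * -s^2 : ℝ) : ℂ))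
/-- incomplete Fresnel integral -/
noncomputable def fresF (R : ℝ) : ℂ := ∫ s in (0:ℝ)..R, Complex.exp (Complex.I * ((-s^2 : ℝ) : ℂ))
/-- auxiliary integral -/
noncomputable def fresQ (R : ℝ) : ℂ :=
  ∫ t in (0:ℝ)..1, Complex.exp (Complex.I * ((-R^2 * (1 + t^2) : ℝ) : ℂ)) * ((1 / (1 + t^2) : ℝ) : ℂ)

lemma fresF_eq (R : ℝ) : fresF R = R * fres (R^2) := by
  have h := intervalIntegral.smul_integral_comp_mul_left (a := 0) (b := 1)
    (fun s => Complex.exp (Complex.I * ((-s^2 : ℝ) : ℂ))) R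
  rw [mul_zero, mul_one] at h
  rw [fresF, ← h, fres, Complex.real_smul]
  congr 2; ext s; congr 3; ring

lemma fres_const (R : ℝ) : fresF R ^ 2 = Complex.I * (fresQ R - π / 4) := by
  have hF : ∀ R, HasDerivAt fresF (Complex.exp (Complex.I * ((-R^2 : ℝ) : ℂ))) R := by
    intro R
    exact (by fun_prop : Continuous fun s : ℝ => Complex.exp (Complex.I * ((-s^2 : ℝ) : ℂ))).integral_hasStrictDerivAt 0 R |>.hasDerivAt
  have hQ : ∀ R, HasDerivAt fresQ (-2 * Complex.I * Complex.exp (Complex.I * ((-R^2 : ℝ) : ℂ)) * fresF R) R := by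
    intro R
    have hpos : ∀ t : ℝ, 1 + t^2 ≠ 0 := fun t => by positivity
    have h := hasDerivAt_param
      (F := fun R t => Complex.exp (Complex.I * ((-R^2 * (1 + t^2) : ℝ) : ℂ)) * ((1 / (1 + t^2) : ℝ) : ℂ))
      (F' := fun R t => -2 * Complex.I * R * Complex.exp (Complex.I * ((-R^2 * (1 + t^2) : ℝ) : ℂ))) 0 1 R
      ?_ ?_ ?_
    · refine h.congr_deriv ?_
      rw [fresF_eq, fres, ← mul_assoc, ← intervalIntegral.integral_const_mul]
      congr 1; ext t
      have : Complex.exp (Complex.I * ((-R^2 * (1 + t^2) : ℝ) : ℂ)) =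
        Complex.exp (Complex.I * ((-R^2 : ℝ) : ℂ)) * Complex.exp (Complex.I * ((R^2 * -t^2 : ℝ) : ℂ)) := by
        rw [← Complex.exp_add]; congr 1; push_cast; ring
      rw [this]; ring
    · simp only [Function.uncurry_def]
      refine Continuous.mul (by fun_prop) (Complex.continuous_ofReal.comp ?_)
      exact Continuous.div (by fun_prop) (by fun_prop) fun p => hpos p.2
    · simp only [Function.uncurry_def]; fun_prop
    · intro y t
      have h0 : HasDerivAt (fun y : ℝ => -y^2 * (1+t^2)) (-(2 * y) * (1 + t^2)) y := by
        simpa using ((hasDerivAt_pow 2 y).neg.mul_const (1 + t^2))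
      have h1 := ((h0.ofReal_comp).const_mul Complex.I).cexp.mul_const ((1 / (1 + t^2) : ℝ) : ℂ)
      refine h1.congr_deriv ?_
      have : (1 + (t:ℂ)^2) ≠ 0 := by exact_mod_cast hpos t
      push_cast
      field_simp
  have hd : ∀ R, HasDerivAt (fun R => fresF R ^ 2 - Complex.I * fresQ R) 0 R := by
    intro R
    refine (((hF R).pow 2).sub ((hQ R).const_mul Complex.I)).congr_deriv ?_
    push_cast
    linear_combination (2 * Complex.exp (Complex.I * (-(R:ℂ)^2)) * fresF R) * Complex.I_sq
  have hc := is_const_of_deriv_eq_zero (fun R => (hd R).differentiableAt) (fun R => (hd R).deriv) R 0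
  have hF0 : fresF 0 = 0 := by simp [fresF]
  have hQ0 : fresQ 0 = π / 4 := by
    have h1 : fresQ 0 = ((∫ t in (0:ℝ)..1, 1 / (1 + t^2) : ℝ) : ℂ) := by
      rw [fresQ, ← intervalIntegral.integral_ofReal]
      congr 1; ext t; simp
    rw [h1, integral_one_div_one_add_sq]; simp
  simp only [hF0, hQ0] at hc
  linear_combination hc

lemma fresQ_norm_le (R : ℝ) : ‖fresQ R‖ ≤ 1 := by
  have := intervalIntegral.norm_integral_le_of_norm_le_const (a := 0) (b := 1) (C := 1)
    (f := fun t : ℝ => Complex.exp (Complex.I * ((-R^2 * (1 + t^2) : ℝ) : ℂ)) * ((1 / (1 + t^2) : ℝ) : ℂ)) ?_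
  · simpa [fresQ] using this
  · intro t _
    rw [norm_mul, norm_exp_I, one_mul, Complex.norm_real, Real.norm_of_nonneg (by positivity)]
    rw [div_le_one (by positivity)]; nlinarith [sq_nonneg t]

lemma fresQ_bound : ∃ C : ℝ, ∀ R : ℝ, 0 < R → ‖fresQ R‖ ≤ ‖fres (R^2)‖ + C / R^2 := by
  have hpos : ∀ t : ℝ, (1 + (t:ℂ)^2) ≠ 0 := fun t => by
    have : (1 + t^2 : ℝ) ≠ 0 := by positivity
    exact_mod_cast this
  obtain ⟨C, hC⟩ := byparts (g := fun t => -t^2) (g' := fun t => -(2*t))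
    (K := fun z => z / (2 * (1 + z^2))) (a := 0) (b := 1) zero_le_one
    (fun t => by simpa using (hasDerivAt_pow 2 t).fun_neg) (by fun_prop)
    (fun t _ => by
      refine AnalyticAt.div (by fun_prop) (by fun_prop) ?_
      exact mul_ne_zero two_ne_zero (hpos t))
  refine ⟨C, fun R hR => ?_⟩
  have h := hC (R^2) (by positivity)
  have e : fresQ R = Complex.exp (Complex.I * ((-R^2 : ℝ) : ℂ)) * (fres (R^2) +
      ∫ t in (0:ℝ)..1, Complex.exp (Complex.I * ((R^2 * -t^2 : ℝ) : ℂ)) *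
        (((-(2*t) : ℝ) : ℂ) * (t / (2 * (1 + (t:ℂ)^2))))) := by
    rw [fres, ← intervalIntegral.integral_add, ← intervalIntegral.integral_const_mul, fresQ]
    · congr 1; ext t
      have : Complex.exp (Complex.I * ((-R^2 * (1 + t^2) : ℝ) : ℂ)) =
        Complex.exp (Complex.I * ((-R^2 : ℝ) : ℂ)) * Complex.exp (Complex.I * ((R^2 * -t^2 : ℝ) : ℂ)) := by
        rw [← Complex.exp_add]; congr 1; push_cast; ring
      rw [this, mul_assoc]
      congr 1
      have := hpos t
      push_cast
      field_simp
      ring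
    · exact Continuous.intervalIntegrable (by fun_prop) _ _
    · refine Continuous.intervalIntegrable ?_ _ _
      refine Continuous.mul (by fun_prop) (Continuous.mul (by fun_prop) ?_)
      exact Continuous.div (by fun_prop) (by fun_prop) fun t => mul_ne_zero two_ne_zero (hpos t)
  rw [e, norm_mul, norm_exp_I, one_mul]
  exact (norm_add_le _ _).trans (by gcongr)

lemma fres_tendsto : Tendsto (fun x : ℝ => x * ‖fres x‖ ^ 2) atTop (𝓝 (π / 4)) := by
  obtain ⟨C, hC⟩ := fresQ_bound
  have hF : ∀ R, ‖fresF R‖ ^ 2 = ‖fresQ R - π / 4‖ := by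
    intro R; rw [← norm_pow, fres_const, norm_mul, Complex.norm_I, one_mul]
  have hG : ∀ R, 0 < R → ‖fres (R^2)‖ ≤ 2 / R := by
    intro R hR
    have h1 := hF R
    have h2 : ‖fresQ R - π / 4‖ ≤ 1 + π / 4 := by
      refine (norm_sub_le _ _).trans (add_le_add (fresQ_norm_le R) (le_of_eq ?_))
      rw [norm_div, Complex.norm_real, Real.norm_of_nonneg pi_pos.le]; simp
    rw [fresF_eq, norm_mul, Complex.norm_real, Real.norm_of_nonneg hR.le] at h1
    have h3 := Real.pi_le_four
    rw [le_div_iff₀ hR]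
    nlinarith [norm_nonneg (fres (R^2))]
  have hQ : Tendsto fresQ atTop (𝓝 0) := by
    have h1 : Tendsto (fun R : ℝ => 2 / R + C / R^2) atTop (𝓝 0) := by
      simpa using (tendsto_const_nhds.div_atTop tendsto_id).add
        ((tendsto_const_nhds (x := C)).div_atTop (tendsto_pow_atTop two_ne_zero))
    refine squeeze_zero_norm' ?_ h1
    filter_upwards [eventually_gt_atTop 0] with R hR
    exact (hC R hR).trans (by gcongr; exact hG R hR)
  have h2 : Tendsto (fun R => ‖fresF R‖ ^ 2) atTop (𝓝 (π / 4)) := by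
    have := (hQ.sub_const ((π:ℂ) / 4)).norm
    rw [zero_sub, norm_neg, norm_div, Complex.norm_real, Real.norm_of_nonneg pi_pos.le] at this
    simpa [hF] using this
  refine (h2.comp Real.tendsto_sqrt_atTop).congr' ?_
  filter_upwards [eventually_ge_atTop 0] with x hx
  simp only [Function.comp]
  rw [fresF_eq, norm_mul, Complex.norm_real, Real.norm_of_nonneg (sqrt_nonneg x), mul_pow, sq_sqrt hx]

end BesselAux

open Real Set Filter Topology MeasureTheory

namespace BesselAux

/-- model oscillatory integral -/
noncomputable def model (x : ℝ) : ℂ :=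
  ∫ θ in (0:ℝ)..π, Complex.exp (Complex.I * ((x * sin θ : ℝ) : ℂ)) * ((cos ((θ - π/2)/2) : ℝ) : ℂ)

lemma model_eq (x : ℝ) :
    model x = (2 * √2 : ℝ) * (Complex.exp (Complex.I * (x:ℂ)) * fres x) := by
  set f : ℝ → ℝ := fun θ => √2 * sin ((θ - π/2)/2) with hf
  have hd : ∀ θ, HasDerivAt f (√2 / 2 * cos ((θ - π/2)/2)) θ := by
    intro θ
    have h1 : HasDerivAt (fun θ : ℝ => (θ - π/2)/2) (1/2) θ :=
      ((hasDerivAt_id θ).sub_const (π/2)).div_const 2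
    exact (h1.sin.const_mul (√2)).congr_deriv (by ring)
  have hs2 : (√2 : ℝ) * √2 = 2 := Real.mul_self_sqrt (by norm_num)
  have f0 : f 0 = -1 := by
    simp only [hf]
    rw [show (0 - π/2)/2 = -(π/4) by ring, sin_neg, sin_pi_div_four]; linarith
  have f1 : f π = 1 := by
    simp only [hf]
    rw [show (π - π/2)/2 = (π/4) by ring, sin_pi_div_four]; linarith
  set g : ℝ → ℂ := fun s => Complex.exp (Complex.I * ((x * -s^2 : ℝ) : ℂ)) with hg
  have hgc : Continuous g := by fun_prop
  have h := intervalIntegral.integral_comp_smul_deriv (a := 0) (b := π) (f := f)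
    (f' := fun θ => √2 / 2 * cos ((θ - π/2)/2)) (g := g) (fun θ _ => hd θ)
    (by fun_prop) hgc
  rw [f0, f1] at h
  have hsplit : ∫ s in (-1:ℝ)..1, g s = 2 * fres x := by
    rw [← intervalIntegral.integral_add_adjacent_intervals (b := 0) (hgc.intervalIntegrable _ _)
      (hgc.intervalIntegrable _ _)]
    have : ∫ s in (-1:ℝ)..0, g s = ∫ s in (0:ℝ)..1, g s := by
      have := intervalIntegral.integral_comp_neg (a := (0:ℝ)) (b := 1) g
      rw [neg_zero] at this
      rw [← this]
      congr 1; ext s; simp [hg]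
    rw [this, fres]; ring
  rw [hsplit] at h
  have e : model x = (√2 : ℝ) * (Complex.exp (Complex.I * (x:ℂ))) *
      ∫ θ in (0:ℝ)..π, (√2 / 2 * cos ((θ - π/2)/2)) • (g ∘ f) θ := by
    rw [← intervalIntegral.integral_const_mul, model]
    congr 1; ext θ
    have hsin : sin θ = 1 + - (f θ)^2 := by
      simp only [hf]
      have h1 : sin θ = cos (2 * ((θ - π/2)/2)) := by
        rw [show 2 * ((θ - π/2)/2) = θ - π/2 by ring, cos_sub_pi_div_two]
      rw [h1, cos_two_mul, mul_pow, sq_sqrt (by norm_num : (0:ℝ) ≤ 2)]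
      have := sin_sq_add_cos_sq ((θ - π/2)/2)
      linarith
    have e1 : Complex.exp (Complex.I * ((x * sin θ : ℝ) : ℂ)) =
        Complex.exp (Complex.I * (x:ℂ)) * g (f θ) := by
      rw [hsin, hg]; simp only []
      rw [← Complex.exp_add]; congr 1; push_cast; ring
    rw [e1, Complex.real_smul, Function.comp]
    have hc2 : ((√2 : ℝ) : ℂ) * ((√2 : ℝ) : ℂ) = 2 := by exact_mod_cast hs2
    push_cast
    linear_combination (-1/2 * Complex.exp (Complex.I * (x:ℂ)) * g (f θ) * Complex.cos ((θ - π/2)/2)) * hc2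
  rw [e, h]
  push_cast; ring

lemma arc_model (ν : ℝ) : ∃ C : ℝ, ∀ x : ℝ, 0 < x →
    ‖arcH ν 0 x - Complex.exp (-(Complex.I * (ν * (π/2)))) * model x‖ ≤ C / x := by
  set c : ℂ := ((π/2 : ℝ) : ℂ) with hc
  set f : ℂ → ℂ := fun z => Complex.exp (-(Complex.I * (ν * (z - c)))) - Complex.cos ((z - c)/2) with hf
  have hfd : Differentiable ℂ f := by fun_prop
  have hcosc : Complex.cos c = 0 := by rw [hc, ← Complex.ofReal_cos, cos_pi_div_two]; simp
  have hfc : f c = 0 := by simp [hf]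
  have an : ∀ F : ℂ → ℂ, Differentiable ℂ F → ∀ z, AnalyticAt ℂ (dslope F c) z := by
    intro F hF z
    have h1 : DifferentiableOn ℂ (dslope F c) univ :=
      (Complex.differentiableOn_dslope univ_mem).2 hF.differentiableOn
    exact h1.analyticAt univ_mem
  have hne : ∀ t ∈ Icc (0:ℝ) π, t ≠ π/2 → cos t ≠ 0 := by
    intro t ht hne h0
    apply hne
    refine injOn_cos ht ⟨by positivity, by linarith [pi_pos]⟩ ?_
    rw [h0, cos_pi_div_two]
  have hds : ∀ t ∈ Icc (0:ℝ) π, dslope Complex.cos c t ≠ 0 := by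
    intro t ht
    by_cases h : t = π/2
    · rw [h, ← hc, dslope_same, Complex.deriv_cos, hc, ← Complex.ofReal_sin, sin_pi_div_two]; simp
    · have h' : (t:ℂ) ≠ c := by rw [hc]; exact_mod_cast h
      rw [dslope_of_ne _ h', slope_def_field, hcosc, sub_zero]
      refine div_ne_zero ?_ (sub_ne_zero.2 h')
      exact_mod_cast hne t ht h
  have hKe : ∀ t ∈ Icc (0:ℝ) π, (cos t : ℂ) * (dslope f c t / dslope Complex.cos c t) = f t := by
    intro t ht
    by_cases h : t = π/2
    · rw [h, ← hc, hfc, cos_pi_div_two]; simp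
    · have h' : (t:ℂ) ≠ c := by rw [hc]; exact_mod_cast h
      have h0 : Complex.cos t ≠ 0 := by exact_mod_cast hne t ht h
      have h1 : (t:ℂ) - c ≠ 0 := sub_ne_zero.2 h'
      rw [dslope_of_ne _ h', dslope_of_ne _ h', slope_def_field, slope_def_field, hcosc, hfc, sub_zero,
        sub_zero, Complex.ofReal_cos]
      field_simp
  obtain ⟨C, hC⟩ := byparts (g := sin) (g' := cos) (K := fun z => dslope f c z / dslope Complex.cos c z)
    (a := 0) (b := π) pi_pos.le (fun t => hasDerivAt_sin t) continuous_cos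
    (fun t ht => (an f hfd t).div (an _ Complex.differentiable_cos t) (hds t ht))
  refine ⟨C, fun x hx => ?_⟩
  have e : arcH ν 0 x - Complex.exp (-(Complex.I * (ν * (π/2)))) * model x =
      Complex.exp (-(Complex.I * (ν * (π/2)))) * ∫ t in (0:ℝ)..π,
      Complex.exp (Complex.I * ((x * sin t : ℝ) : ℂ)) *
        ((cos t : ℂ) * (dslope f c t / dslope Complex.cos c t)) := by
    rw [arcH, model, ← intervalIntegral.integral_const_mul, ← intervalIntegral.integral_const_mul,
      ← intervalIntegral.integral_sub (Continuous.intervalIntegrable (by fun_prop) _ _)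
      (Continuous.intervalIntegrable (by fun_prop) _ _)]
    refine intervalIntegral.integral_congr fun t ht => ?_
    rw [uIcc_of_le pi_pos.le] at ht
    beta_reduce
    rw [hKe t ht, hf]
    beta_reduce
    have e1 : Complex.exp (Complex.I * (x * sin t - ν * t)) =
      Complex.exp (-(Complex.I * (ν * (π/2)))) * (Complex.exp (Complex.I * ((x * sin t : ℝ) : ℂ)) *
       Complex.exp (-(Complex.I * (ν * (t - c))))) := by
      rw [← Complex.exp_add, ← Complex.exp_add, hc]; congr 1; push_cast; ring
    rw [e1, hc]
    push_cast
    ring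
  have en : ‖Complex.exp (-(Complex.I * (ν * (π/2))))‖ = 1 := by
    have := norm_exp_I (-(ν * (π/2)))
    rw [← this]; congr 2; push_cast; ring
  rw [e, norm_mul, en, one_mul]
  exact hC x hx

lemma arc_diff (ν : ℝ) : ∃ C : ℝ, ∀ x : ℝ, 0 < x →
    ‖arcH ν 1 x - Complex.I * arcH ν 0 x‖ ≤ C / x := by
  have hp : ∀ t ∈ Icc (0:ℝ) π, 1 + Complex.sin t ≠ 0 := by
    intro t ht
    have h1 : 1 + sin t ≠ 0 := by
      have := sin_nonneg_of_nonneg_of_le_pi ht.1 ht.2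
      linarith
    exact_mod_cast h1
  obtain ⟨C, hC⟩ := byparts (g := sin) (g' := cos)
    (K := fun z => -Complex.I * Complex.cos z / (1 + Complex.sin z) * Complex.exp (-(Complex.I * (ν * z))))
    (a := 0) (b := π) pi_pos.le (fun t => hasDerivAt_sin t) continuous_cos
    (fun t ht => by
      refine AnalyticAt.mul (AnalyticAt.div ?_ ?_ (hp t ht)) ?_
      · exact (by fun_prop : Differentiable ℂ fun z => -Complex.I * Complex.cos z).analyticAt _
      · exact (by fun_prop : Differentiable ℂ fun z => 1 + Complex.sin z).analyticAt _
      · exact (by fun_prop : Differentiable ℂ fun z : ℂ => Complex.exp (-(Complex.I * (ν * z)))).analyticAt _)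
  refine ⟨C, fun x hx => ?_⟩
  refine le_trans (le_of_eq ?_) (hC x hx)
  congr 1
  rw [arcH, arcH, ← intervalIntegral.integral_const_mul,
      ← intervalIntegral.integral_sub (Continuous.intervalIntegrable (by fun_prop) _ _)
      (Continuous.intervalIntegrable (by fun_prop) _ _)]
  refine intervalIntegral.integral_congr fun t ht => ?_
  rw [uIcc_of_le pi_pos.le] at ht
  beta_reduce
  have e1 : Complex.exp (Complex.I * (x * sin t - ν * t)) =
      Complex.exp (Complex.I * ((x * sin t : ℝ) : ℂ)) * Complex.exp (-(Complex.I * (ν * t))) := by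
    rw [← Complex.exp_add]; congr 1; push_cast; ring
  rw [e1]
  have h0 := hp t ht
  have h2 := Complex.sin_sq_add_cos_sq t
  push_cast
  have h3 : Complex.cos t * (-Complex.I * Complex.cos t / (1 + Complex.sin t)) = Complex.I * Complex.sin t - Complex.I := by
    field_simp
    linear_combination -h2
  linear_combination (-Complex.exp (Complex.I * (x * Complex.sin t)) * Complex.exp (-(Complex.I * (ν * t)))) * h3

lemma rayH_bound (ν : ℝ) (j : ℕ) (hj : j ≤ 1) {x : ℝ} (hx : ν + 1 < x) (hx1 : 1 < x) :
    |rayH ν j x| ≤ 1 / (x - ν - 1) := by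
  have h0 : ∫ t in Ioi (0:ℝ), exp (-(x - ν - 1) * t) = 1 / (x - ν - 1) := by
    rw [integral_exp_mul_Ioi (by linarith), mul_zero, exp_zero, neg_div_neg_eq]
  rw [← h0, ← Real.norm_eq_abs, rayH]
  refine norm_integral_le_of_norm_le ?_ ?_
  · exact integrableOn_exp_mul_Ioi (by linarith) 0
  · refine (ae_restrict_iff' measurableSet_Ioi).2 (Eventually.of_forall fun t ht => ?_)
    have ht' : (0:ℝ) < t := ht
    have hs : t ≤ sinh t := Real.self_le_sinh_iff.2 ht'.le
    have hs0 : 0 < sinh t := by linarith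
    rw [norm_mul, norm_mul, norm_pow, norm_neg, Real.norm_of_nonneg (exp_pos _).le,
      Real.norm_of_nonneg (exp_pos _).le, Real.norm_of_nonneg hs0.le]
    have h1 : sinh t ^ j ≤ exp (sinh t) := by
      have := Real.add_one_le_exp (sinh t)
      interval_cases j
      · simp; linarith
      · simp; linarith
    calc exp (ν * t) * sinh t ^ j * exp (-x * sinh t) ≤ exp (ν * t) * exp (sinh t) * exp (-x * sinh t) := by gcongr
      _ = exp (ν * t + sinh t + -x * sinh t) := by rw [exp_add, exp_add]
      _ ≤ _ := by
        rw [exp_le_exp]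
        nlinarith

lemma small_of_bound {f : ℝ → ℂ} (C : ℝ) (h : ∀ x : ℝ, 0 < x → ‖f x‖ ≤ C / x) :
    Tendsto (fun x : ℝ => (√x : ℂ) * f x) atTop (𝓝 0) := by
  have h1 : Tendsto (fun x : ℝ => C / √x) atTop (𝓝 0) :=
    tendsto_const_nhds.div_atTop Real.tendsto_sqrt_atTop
  refine squeeze_zero_norm' ?_ h1
  filter_upwards [eventually_gt_atTop 0] with x hx
  rw [norm_mul, Complex.norm_real, Real.norm_of_nonneg (sqrt_nonneg x)]
  calc √x * ‖f x‖ ≤ √x * (C / x) := by gcongr; exact h x hx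
    _ = C / √x := by
      have : √x * √x = x := mul_self_sqrt hx.le
      have h0 : √x ≠ 0 := (sqrt_pos.2 hx).ne'
      nth_rewrite 2 [← this]
      field_simp

lemma ray_small (ν : ℝ) (j : ℕ) (hj : j ≤ 1) :
    Tendsto (fun x : ℝ => (√x : ℂ) * rayH ν j x) atTop (𝓝 0) := by
  have h1 : Tendsto (fun x : ℝ => 2 / √x) atTop (𝓝 0) :=
    tendsto_const_nhds.div_atTop Real.tendsto_sqrt_atTop
  refine squeeze_zero_norm' ?_ h1
  filter_upwards [eventually_gt_atTop 1, eventually_gt_atTop (2 * (ν + 1)), eventually_gt_atTop (ν + 1)] with x hx1 hx2 hx3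
  have hx : 0 < x := by linarith
  rw [norm_mul, Complex.norm_real, Complex.norm_real, Real.norm_of_nonneg (sqrt_nonneg x)]
  calc √x * |rayH ν j x| ≤ √x * (1 / (x - ν - 1)) := by gcongr; exact rayH_bound ν j hj hx3 hx1
    _ ≤ √x * (2 / x) := by
      gcongr √x * ?_
      rw [div_le_div_iff₀ (by linarith) hx]; linarith
    _ = 2 / √x := by
      have : √x * √x = x := mul_self_sqrt hx.le
      have h0 : √x ≠ 0 := (sqrt_pos.2 hx).ne'
      nth_rewrite 2 [← this]
      field_simp

lemma HH_diff (ν : ℝ) :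
    Tendsto (fun x : ℝ => (√x : ℂ) * (HH ν 1 x - Complex.I * HH ν 0 x)) atTop (𝓝 0) := by
  obtain ⟨C, hC⟩ := arc_diff ν
  have h1 := small_of_bound C hC
  have h2 := ((ray_small ν 1 le_rfl).sub ((ray_small ν 0 zero_le_one).const_mul Complex.I)).const_mul Complex.I
  have h3 := ((ray_small (-ν) 1 le_rfl).sub ((ray_small (-ν) 0 zero_le_one).const_mul Complex.I)).const_mul
    (Complex.I * Complex.exp (-(Complex.I * (ν * π))))
  have h4 := ((h1.sub h2).sub h3).const_mul (1 / π : ℂ)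
  simp only [mul_zero, sub_zero] at h4
  refine h4.congr fun x => ?_
  simp only [HH]; ring

lemma HH_norm (ν : ℝ) : Tendsto (fun x : ℝ => x * ‖HH ν 0 x‖ ^ 2) atTop (𝓝 (2 / π)) := by
  obtain ⟨C, hC⟩ := arc_model ν
  have h1 := small_of_bound C hC
  have h2 := ((ray_small ν 0 zero_le_one)).const_mul Complex.I
  have h3 := ((ray_small (-ν) 0 zero_le_one)).const_mul
    (Complex.I * Complex.exp (-(Complex.I * (ν * π))))
  have h4 := ((h1.sub h2).sub h3).const_mul (1 / π : ℂ)
  simp only [mul_zero, sub_zero] at h4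
  set m : ℝ → ℂ := fun x => (√x : ℂ) * ((1/π : ℂ) * (Complex.exp (-(Complex.I * (ν * (π/2)))) * model x))
  have en : ‖Complex.exp (-(Complex.I * (ν * (π/2))))‖ = 1 := by
    have := norm_exp_I (-(ν * (π/2)))
    rw [← this]; congr 2; push_cast; ring
  have hm2 : Tendsto (fun x => ‖m x‖ ^ 2) atTop (𝓝 (2 / π)) := by
    have h5 := fres_tendsto.const_mul (8 / π^2)
    rw [show 8 / π^2 * (π / 4) = 2 / π by field_simp; norm_num] at h5
    refine h5.congr' ?_
    filter_upwards [eventually_gt_atTop 0] with x hx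
    simp only [m]
    rw [model_eq]
    simp only [norm_mul, en, norm_exp_I, norm_div, Complex.norm_real, norm_one, one_mul]
    rw [Real.norm_of_nonneg (sqrt_nonneg x), Real.norm_of_nonneg pi_pos.le, mul_pow, mul_pow, mul_pow,
      sq_sqrt hx.le, Real.norm_of_nonneg (sqrt_nonneg 2), mul_pow, sq_sqrt (by norm_num : (0:ℝ) ≤ 2)]
    norm_num
    ring
  have hm : Tendsto (fun x => ‖m x‖) atTop (𝓝 (√(2/π))) := by
    have := (Real.continuous_sqrt.tendsto _).comp hm2
    refine this.congr fun x => ?_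
    simp [Function.comp, sqrt_sq (norm_nonneg _)]
  have hH : Tendsto (fun x : ℝ => ‖(√x : ℂ) * HH ν 0 x‖) atTop (𝓝 (√(2/π))) := by
    have hdiff : Tendsto (fun x : ℝ => ‖(√x : ℂ) * HH ν 0 x‖ - ‖m x‖) atTop (𝓝 0) := by
      refine squeeze_zero_norm (fun x => abs_norm_sub_norm_le _ _) ?_
      have := h4.norm
      rw [norm_zero] at this
      refine this.congr fun x => ?_
      congr 1
      simp only [HH, m]; ring
    have := hdiff.add hm
    simpa using this
  have hH2 := hH.pow 2
  rw [sq_sqrt (by positivity)] at hH2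
  refine hH2.congr' ?_
  filter_upwards [eventually_gt_atTop 0] with x hx
  rw [norm_mul, mul_pow, Complex.norm_real, Real.norm_of_nonneg (sqrt_nonneg x), sq_sqrt hx.le]

end BesselAux

open Real Set Filter Topology MeasureTheory
namespace BesselAux

lemma zb {f g : ℝ → ℝ} {C : ℝ} (hf : Tendsto f atTop (𝓝 0)) (hg : ∀ᶠ x in atTop, |g x| ≤ C) :
    Tendsto (fun x => f x * g x) atTop (𝓝 0) := by
  have h1 : Tendsto (fun x => |f x| * C) atTop (𝓝 0) := by
    simpa using (hf.abs).mul_const C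
  refine squeeze_zero_norm' ?_ h1
  filter_upwards [hg] with x hx
  rw [norm_mul]
  exact mul_le_mul_of_nonneg_left hx (norm_nonneg _)

lemma norm_sqrt_bound (ν : ℝ) : ∀ᶠ x : ℝ in atTop, ‖(√x : ℂ) * HH ν 0 x‖ ≤ 1 := by
  have hW : 2 / π < 1 := by rw [div_lt_one pi_pos]; linarith [pi_gt_three]
  filter_upwards [(HH_norm ν).eventually (gt_mem_nhds hW), eventually_gt_atTop 0] with x hx h0
  have : ‖(√x : ℂ) * HH ν 0 x‖ ^ 2 = x * ‖HH ν 0 x‖ ^ 2 := by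
    rw [norm_mul, mul_pow, Complex.norm_real, Real.norm_eq_abs, sq_abs, sq_sqrt h0.le]
  nlinarith [norm_nonneg ((√x : ℂ) * HH ν 0 x)]

lemma deriv_re (ν : ℝ) (j : ℕ) (c : ℂ) {x : ℝ} (hx : 0 < x) :
    HasDerivAt (fun y : ℝ => (c * HH ν j y).re) (c * HH ν (j+1) x).re x :=
  Complex.reCLM.hasFDerivAt.comp_hasDerivAt x ((HH_deriv ν j hx).const_mul c)

lemma ode_re (ν : ℝ) (c : ℂ) {x : ℝ} (hx : 0 < x) :
    x^2 * (c * HH ν 2 x).re + x * (c * HH ν 1 x).re + (x^2 - ν^2) * (c * HH ν 0 x).re = 0 := by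
  have h := HH_ode ν hx
  have h1 : (c * ((x:ℂ)^2 * HH ν 2 x + x * HH ν 1 x + ((x:ℂ)^2 - ν^2) * HH ν 0 x)).re = 0 := by
    rw [h]; simp
  rw [← h1]
  have : c * ((x:ℂ)^2 * HH ν 2 x + x * HH ν 1 x + ((x:ℂ)^2 - ν^2) * HH ν 0 x) =
    ((x^2 : ℝ) : ℂ) * (c * HH ν 2 x) + (x : ℝ) * (c * HH ν 1 x) + ((x^2 - ν^2 : ℝ) : ℂ) * (c * HH ν 0 x) := by
    push_cast; ring
  rw [this, Complex.add_re, Complex.add_re, Complex.re_ofReal_mul, Complex.re_ofReal_mul,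
    Complex.re_ofReal_mul]

lemma im_eq (w : ℂ) : w.im = (-Complex.I * w).re := by simp

lemma wronsk (ν : ℝ) {x : ℝ} (hx : 0 < x) :
    x * ((HH ν 0 x).re * (HH ν 1 x).im - (HH ν 1 x).re * (HH ν 0 x).im) = 2 / π := by
  set w : ℝ → ℝ := fun x => x * ((HH ν 0 x).re * (HH ν 1 x).im - (HH ν 1 x).re * (HH ν 0 x).im) with hw
  have hd : ∀ y : ℝ, 0 < y → HasDerivAt w 0 y := by
    intro y hy
    have hr := fun j => deriv_re ν j 1 hy
    have hi := fun j => deriv_re ν j (-Complex.I) hy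
    have or := ode_re ν 1 hy
    have oi := ode_re ν (-Complex.I) hy
    simp only [← im_eq, one_mul] at hr hi or oi
    have := (hasDerivAt_id y).mul (((hr 0).mul (hi 1)).sub ((hr 1).mul (hi 0)))
    refine this.congr_deriv ?_
    simp only [id, Pi.mul_apply, Pi.sub_apply]
    norm_num at *
    apply mul_left_cancel₀ hy.ne'
    linear_combination (HH ν 0 y).re * oi - (HH ν 0 y).im * or
  have hl : Tendsto w atTop (𝓝 (2/π)) := by
    have h1 : Tendsto (fun x : ℝ => ‖(√x:ℂ) * (HH ν 1 x - Complex.I * HH ν 0 x)‖) atTop (𝓝 0) := by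
      simpa using (HH_diff ν).norm
    have h2 : Tendsto (fun x : ℝ => w x - x * ‖HH ν 0 x‖^2) atTop (𝓝 0) := by
      refine squeeze_zero_norm' ?_ h1
      filter_upwards [norm_sqrt_bound ν, eventually_gt_atTop 0] with y hb hy
      have e : w y - y * ‖HH ν 0 y‖^2 =
        ((starRingEnd ℂ) ((√y:ℂ) * HH ν 0 y) * ((√y:ℂ) * (HH ν 1 y - Complex.I * HH ν 0 y))).im := by
        rw [← Complex.normSq_eq_norm_sq, Complex.normSq_apply, hw]
        simp
        linear_combination (-(HH ν 0 y).re * ((HH ν 1 y).im - (HH ν 0 y).re) + (HH ν 0 y).im * ((HH ν 1 y).re + (HH ν 0 y).im)) * mul_self_sqrt hy.le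
      rw [e, Real.norm_eq_abs]
      refine (Complex.abs_im_le_norm _).trans ?_
      rw [norm_mul, RCLike.norm_conj]
      exact mul_le_of_le_one_left (norm_nonneg _) hb
    simpa using h2.add (HH_norm ν)
  have hc : ∀ y, x < y → w y = w x := by
    intro y hy
    refine (constant_of_has_deriv_right_zero (f := w) (a := x) (b := y) ?_ ?_) y (right_mem_Icc.2 hy.le)
    · intro t ht; exact (hd t (hx.trans_le ht.1)).continuousAt.continuousWithinAt
    · intro t ht; exact (hd t (hx.trans_le ht.1)).hasDerivWithinAt
  have h3 : Tendsto w atTop (𝓝 (w x)) :=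
    tendsto_const_nhds.congr' (by filter_upwards [eventually_gt_atTop x] with y hy using (hc y hy).symm)
  exact tendsto_nhds_unique h3 hl

noncomputable def GG (ν : ℝ) (c : ℂ) (x : ℝ) : ℝ :=
  (-2*x^2/√(x^2-ν^2)^3 + 3*x^4/√(x^2-ν^2)^5) * (c * HH ν 0 x).re^2
  - 2 * (-x^2/√(x^2-ν^2)^3) * (c * HH ν 0 x).re * (x * (c * HH ν 1 x).re)
  + 2 * (1/√(x^2-ν^2)) * ((x * (c * HH ν 1 x).re)^2 + (x^2-ν^2) * (c * HH ν 0 x).re^2)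

lemma GG_deriv (ν : ℝ) (hν : 0 ≤ ν) (c : ℂ) {x : ℝ} (hx : ν < x) :
    HasDerivAt (GG ν c) (-x*(x^4+10*x^2*ν^2+4*ν^4)/√(x^2-ν^2)^7 * (c * HH ν 0 x).re^2) x := by
  have hx0 : 0 < x := hν.trans_lt hx
  have hq : 0 < x^2 - ν^2 := by nlinarith
  have hr : HasDerivAt (fun y : ℝ => √(y^2-ν^2)) (x/√(x^2-ν^2)) x := by
    have := (((hasDerivAt_id x).pow 2).sub_const (ν^2)).sqrt hq.ne'
    refine this.congr_deriv ?_
    simp; field_simp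
  have hq' : HasDerivAt (fun y : ℝ => y^2-ν^2) (2*x) x := by
    simpa using ((hasDerivAt_id x).pow 2).sub_const (ν^2)
  have hrp : 0 < √(x^2-ν^2) := sqrt_pos.2 hq
  have hr2 : √(x^2-ν^2)^2 = x^2 - ν^2 := sq_sqrt hq.le
  have hp := fun n : ℕ => (hasDerivAt_pow n x)
  have hf : HasDerivAt (fun y : ℝ => 1/√(y^2-ν^2)) (-x/√(x^2-ν^2)^3) x := by
    refine ((hasDerivAt_const x (1:ℝ)).div hr hrp.ne').congr_deriv ?_
    field_simp
    try ring
  have hf1 : HasDerivAt (fun y : ℝ => -y^2/√(y^2-ν^2)^3) (-2*x/√(x^2-ν^2)^3 + 3*x^3/√(x^2-ν^2)^5) x := by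
    refine ((hp 2).neg.div (hr.pow 3) (pow_pos hrp 3).ne').congr_deriv ?_
    simp; field_simp
  have hf2 : HasDerivAt (fun y : ℝ => -2*y^2/√(y^2-ν^2)^3 + 3*y^4/√(y^2-ν^2)^5)
      (-x*(x^4+10*x^2*ν^2+4*ν^4)/√(x^2-ν^2)^7) x := by
    refine ((((hp 2).const_mul (-2)).div (hr.pow 3) (pow_pos hrp 3).ne').add
      (((hp 4).const_mul 3).div (hr.pow 5) (pow_pos hrp 5).ne')).congr_deriv ?_
    have hν2 : ν^2 = x^2 - √(x^2-ν^2)^2 := by linarith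
    have hν4 : ν^4 = (x^2 - √(x^2-ν^2)^2)^2 := by rw [← hν2]; ring
    simp only [Pi.pow_apply]
    generalize √(x^2-ν^2) = r at *
    rw [hν4, hν2]
    norm_num
    field_simp
    ring
  have z0 := deriv_re ν 0 c hx0
  have z1 := deriv_re ν 1 c hx0
  have o := ode_re ν c hx0
  have hid := hasDerivAt_id x
  have key := ((hf2.mul (z0.pow 2)).sub (((hf1.const_mul 2).mul z0).mul (hid.mul z1))).add
    ((hf.const_mul 2).mul (((hid.mul z1).pow 2).add (hq'.mul (z0.pow 2))))
  refine key.congr_deriv ?_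
  simp only [Pi.mul_apply, Pi.pow_apply, Pi.add_apply, Pi.sub_apply, id]
  norm_num
  have hν2 : ν^2 = x^2 - √(x^2-ν^2)^2 := by linarith
  simp only [← Complex.mul_re] at *
  set r := √(x^2-ν^2) with hrr
  generalize (c * HH ν 0 x).re = a at *
  generalize (c * HH ν 1 x).re = b at *
  generalize (c * HH ν 2 x).re = d at *
  have hd : d = -(x*b + r^2*a)/x^2 := by field_simp; rw [hr2]; linarith
  clear_value r
  rw [hd, hν2]
  field_simp
  ring

end BesselAux

open Real Set Filter Topology MeasureTheory
namespace BesselAux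

lemma s_tendsto (ν : ℝ) : Tendsto (fun x : ℝ => √(x^2-ν^2)/x) atTop (𝓝 1) := by
  have h1 : Tendsto (fun x : ℝ => √(1 - (ν * x⁻¹)^2)) atTop (𝓝 (√(1 - (ν*0)^2))) :=
    (((tendsto_inv_atTop_zero.const_mul ν).pow 2).const_sub 1).sqrt
  simp only [mul_zero, ne_eq, OfNat.ofNat_ne_zero, not_false_eq_true, zero_pow, sub_zero, sqrt_one] at h1
  refine h1.congr' ?_
  filter_upwards [eventually_gt_atTop 0] with x hx
  have : 1 - (ν * x⁻¹)^2 = (x^2 - ν^2)/x^2 := by field_simp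
  rw [this, sqrt_div' _ (sq_nonneg x), sqrt_sq hx.le]

lemma GG_limit (ν : ℝ) (hν : 0 ≤ ν) (c : ℂ) :
    Tendsto (GG ν c) atTop (𝓝 (2 * (‖c‖^2 * (2/π)))) := by
  set s : ℝ → ℝ := fun x => √(x^2-ν^2)/x with hs
  have ts : Tendsto s atTop (𝓝 1) := s_tendsto ν
  have ti : Tendsto (fun x : ℝ => x⁻¹) atTop (𝓝 0) := tendsto_inv_atTop_zero
  set a : ℝ → ℝ := fun x => √x * (c * HH ν 0 x).re with ha
  set b : ℝ → ℝ := fun x => √x * (c * HH ν 0 x).im with hb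
  set d : ℝ → ℝ := fun x => (c * ((√x:ℂ) * (HH ν 1 x - Complex.I * HH ν 0 x))).re with hd
  have td : Tendsto d atTop (𝓝 0) := by
    have := Complex.continuous_re.continuousAt.tendsto.comp ((HH_diff ν).const_mul c)
    simp only [mul_zero, Complex.zero_re] at this
    exact this
  have tab : Tendsto (fun x => a x^2 + b x^2) atTop (𝓝 (‖c‖^2 * (2/π))) := by
    refine ((HH_norm ν).const_mul (‖c‖^2)).congr' ?_
    filter_upwards [eventually_gt_atTop 0] with x hx
    have h1 : ‖c‖^2 * (x * ‖HH ν 0 x‖^2) = x * ‖c * HH ν 0 x‖^2 := by rw [norm_mul]; ring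
    rw [h1, ← Complex.normSq_eq_norm_sq, Complex.normSq_apply, ha, hb]
    simp only [mul_pow, sq_sqrt hx.le]
    ring
  set K : ℝ := ‖c‖^2 * (2/π) + 1 with hK
  have hK1 : 1 ≤ K := by have : 0 ≤ ‖c‖^2 * (2/π) := by positivity
                         linarith
  have e1 : ∀ᶠ x in atTop, |a x| ≤ K ∧ |b x| ≤ K ∧ |d x| ≤ 1 := by
    filter_upwards [tab.eventually (gt_mem_nhds (lt_add_one _)),
      td.abs.eventually (gt_mem_nhds (by simp : |(0:ℝ)| < 1))] with x h1 h2
    refine ⟨?_, ?_, h2.le⟩ <;> apply abs_le_of_sq_le_sq _ (by linarith) <;>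
      nlinarith [sq_nonneg (a x), sq_nonneg (b x)]
  have ba : ∀ᶠ x in atTop, |a x ^ 2| ≤ K^2 := by
    filter_upwards [e1] with x h
    rw [abs_pow]; exact pow_le_pow_left₀ (abs_nonneg _) h.1 2
  have bb : ∀ᶠ x in atTop, |(d x - b x)| ≤ 1 + K := by
    filter_upwards [e1] with x h
    exact (abs_sub _ _).trans (add_le_add h.2.2 h.2.1)
  have bab : ∀ᶠ x in atTop, |a x * (d x - b x)| ≤ K * (1+K) := by
    filter_upwards [e1, bb] with x h h'
    rw [abs_mul]; exact mul_le_mul h.1 h' (abs_nonneg _) (by linarith)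
  have bb2 : ∀ᶠ x in atTop, |(d x - b x)^2| ≤ (1+K)^2 := by
    filter_upwards [bb] with x h
    rw [abs_pow]; exact pow_le_pow_left₀ (abs_nonneg _) h 2
  have bdb : ∀ᶠ x in atTop, |d x - 2 * b x| ≤ 1 + 2 * K := by
    filter_upwards [e1] with x h
    refine (abs_sub _ _).trans (add_le_add h.2.2 ?_)
    rw [abs_mul, abs_two]; linarith [h.2.1]
  have tinv : ∀ n : ℕ, Tendsto (fun x => (s x ^ n)⁻¹) atTop (𝓝 1) := by
    intro n; simpa using (ts.pow n).inv₀ (by simp)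
  have c1 : Tendsto (fun x : ℝ => (x⁻¹)^2 * (-2 * (s x^3)⁻¹ + 3 * (s x^5)⁻¹) + 2 * (s x - 1)) atTop (𝓝 0) := by
    have := ((ti.pow 2).mul (((tinv 3).const_mul (-2)).add ((tinv 5).const_mul 3))).add ((ts.sub_const 1).const_mul 2)
    simpa using this
  have c2 : Tendsto (fun x : ℝ => 2 * (x⁻¹ * (s x^3)⁻¹)) atTop (𝓝 0) := by
    have := (ti.mul (tinv 3)).const_mul 2
    simpa using this
  have c3 : Tendsto (fun x : ℝ => 2 * ((s x^1)⁻¹ - 1)) atTop (𝓝 0) := by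
    have := ((tinv 1).sub_const 1).const_mul 2
    simpa using this
  have T := (((((tab.const_mul 2).add (zb c1 ba)).add (zb c2 bab)).add (zb c3 bb2)).add
    ((zb td bdb).const_mul 2))
  simp only [mul_zero, add_zero] at T
  refine T.congr' ?_
  filter_upwards [eventually_gt_atTop ν] with x hx
  have hx0 : 0 < x := hν.trans_lt hx
  have hq : 0 < x^2 - ν^2 := by nlinarith
  have hrp : 0 < √(x^2-ν^2) := sqrt_pos.2 hq
  have hr2 : √(x^2-ν^2)^2 = x^2 - ν^2 := sq_sqrt hq.le
  have hz : √x * (c * HH ν 1 x).re = d x - b x := by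
    have : c * ((√x:ℂ) * (HH ν 1 x - Complex.I * HH ν 0 x)) =
      ((√x:ℝ):ℂ) * (c * HH ν 1 x) - ((√x:ℝ):ℂ) * (Complex.I * (c * HH ν 0 x)) := by ring
    rw [hd, hb]
    simp only [this, Complex.sub_re, Complex.re_ofReal_mul, Complex.I_mul_re]
    ring
  have hsx : 0 < √x := sqrt_pos.2 hx0
  have hsx2 : √x^2 = x := sq_sqrt hx0.le
  have h0 : (c * HH ν 0 x).re = a x / √x := by rw [ha]; field_simp
  have h1 : (c * HH ν 1 x).re = (d x - b x) / √x := by rw [← hz]; field_simp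
  have hsr : √(x^2-ν^2) = x * s x := by rw [hs]; field_simp
  have hs0 : 0 < s x := div_pos hrp hx0
  rw [GG, h0, h1, hsr, ← hr2, hsr]
  generalize a x = a at *
  generalize b x = b at *
  generalize d x = d at *
  generalize s x = s at *
  simp only [div_pow, mul_pow, hsx2]
  have : x * ((d - b)/√x) * (a / √x) = (d-b) * a := by field_simp; rw [hsx2]; ring
  have h3 : 2 * (-x ^ 2 / (x ^ 3 * s ^ 3)) * (a / √x) * (x * ((d - b) / √x)) =  2 * (-x ^ 2 / (x ^ 3 * s ^ 3)) *((d-b)*a) := by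
    rw [← this]; ring
  rw [h3]
  field_simp
  ring

theorem modulus_lt (ν x : ℝ) (hν : 0 ≤ ν) (hx : ν < x) :
    (HH ν 0 x).re ^ 2 + (HH ν 0 x).im ^ 2 < (2/π) * (1 / √(x^2 - ν^2)) := by
  have hx0 : 0 < x := hν.trans_lt hx
  have hq : 0 < x^2 - ν^2 := by nlinarith
  have hrp : 0 < √(x^2-ν^2) := sqrt_pos.2 hq
  have hw := wronsk ν hx0
  have hW : 0 < 2/π := by positivity
  set c : ℂ := ⟨(HH ν 0 x).im, (HH ν 0 x).re⟩ with hc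
  have hcn : ‖c‖^2 = (HH ν 0 x).re ^ 2 + (HH ν 0 x).im ^ 2 := by
    rw [← Complex.normSq_eq_norm_sq, Complex.normSq_apply, hc]; ring
  have hz0 : (c * HH ν 0 x).re = 0 := by rw [Complex.mul_re, hc]; ring
  have hz1 : x * (c * HH ν 1 x).re = -(2/π) := by rw [← hw, Complex.mul_re, hc]; ring
  have hp : 0 < ‖c‖^2 := by
    rcases (sq_nonneg ‖c‖).eq_or_lt with h | h
    · have : c = 0 := by simpa using h.symm
      rw [this] at hz1
      simp at hz1
    · exact h
  rw [← hcn]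
  have hG : GG ν c x = 2 * (1/√(x^2-ν^2)) * (2/π)^2 := by
    rw [GG, hz0, hz1]; ring
  have hlim := GG_limit ν hν c
  have hle : ∀ y, ν < y → -y*(y^4+10*y^2*ν^2+4*ν^4)/√(y^2-ν^2)^7 * (c * HH ν 0 y).re^2 ≤ 0 := by
    intro y hy
    have : 0 < y := hν.trans_lt hy
    have h1 : 0 ≤ y*(y^4+10*y^2*ν^2+4*ν^4)/√(y^2-ν^2)^7 * (c * HH ν 0 y).re^2 := by positivity
    rw [neg_mul, neg_div, neg_mul]; linarith
  have hanti : AntitoneOn (GG ν c) (Ioi ν) := by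
    refine antitoneOn_of_deriv_nonpos (convex_Ioi ν) ?_ ?_ ?_
    · intro y hy; exact (GG_deriv ν hν c hy).continuousAt.continuousWithinAt
    · intro y hy; rw [interior_Ioi] at hy
      exact (GG_deriv ν hν c hy).differentiableAt.differentiableWithinAt
    · intro y hy; rw [interior_Ioi] at hy
      rw [(GG_deriv ν hν c hy).deriv]; exact hle y hy
  have hge : ∀ y, ν < y → 2 * (‖c‖^2 * (2/π)) ≤ GG ν c y := by
    intro y hy
    refine le_of_tendsto hlim ?_
    filter_upwards [eventually_ge_atTop y] with t ht
    exact hanti hy (hy.trans_le ht) ht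
  have hstrict : 2 * (‖c‖^2 * (2/π)) < GG ν c x := by
    refine lt_of_le_of_ne (hge x hx) fun heq => ?_
    have hconst : ∀ y, x ≤ y → GG ν c y = 2 * (‖c‖^2 * (2/π)) := fun y hy =>
      le_antisymm ((hanti hx (hx.trans_le hy) hy).trans heq.symm.le) (hge y (hx.trans_le hy))
    have hz : ∀ y, x < y → (c * HH ν 0 y).re = 0 := by
      intro y hy
      have hνy := hx.trans hy
      have hy0 : 0 < y := hν.trans_lt hνy
      have h1 : HasDerivAt (GG ν c) 0 y :=
        (hasDerivAt_const y (2 * (‖c‖^2 * (2/π)))).congr_of_eventuallyEq (by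
          filter_upwards [lt_mem_nhds hy] with t ht using hconst t ht.le)
      have h2 := (GG_deriv ν hν c hνy).unique h1
      have hqy : 0 < y^2 - ν^2 := by nlinarith
      have h3 : 0 < y*(y^4+10*y^2*ν^2+4*ν^4)/√(y^2-ν^2)^7 := by
        have := sqrt_pos.2 hqy
        positivity
      have h4 : y*(y^4+10*y^2*ν^2+4*ν^4)/√(y^2-ν^2)^7 * (c * HH ν 0 y).re^2 = 0 := by
        rw [neg_mul, neg_div, neg_mul] at h2; linarith
      have := (mul_eq_zero.1 h4).resolve_left h3.ne'
      exact pow_eq_zero_iff two_ne_zero |>.1 this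
    have hy : x < x + 1 := by linarith
    have hz' : (c * HH ν 1 (x+1)).re = 0 := by
      have h1 : HasDerivAt (fun t : ℝ => (c * HH ν 0 t).re) 0 (x+1) :=
        (hasDerivAt_const (x+1) (0:ℝ)).congr_of_eventuallyEq (by
          filter_upwards [lt_mem_nhds hy] with t ht using hz t ht)
      exact (deriv_re ν 0 c (by linarith)).unique h1
    have h5 := hconst (x+1) hy.le
    rw [GG, hz _ hy, hz'] at h5
    have : 0 < 2 * (‖c‖^2 * (2/π)) := by positivity
    rw [← h5] at this
    simp at this
  rw [hG] at hstrict
  have : (‖c‖^2) * (2/π) < (2/π * (1/√(x^2-ν^2))) * (2/π) := by linarith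
  exact lt_of_mul_lt_mul_right this hW.le

end BesselAux

end

theorem stmt16 (ν x : ℝ) (hν : 0 ≤ ν) (hx : ν < x) :
    besselJ ν x ^ 2 + besselY ν x ^ 2 < (2/Real.pi) * (1 / Real.sqrt (x^2 - ν^2)) := by
  have hx0 : 0 < x := lt_of_le_of_lt hν hx
  have h := BesselAux.modulus_lt ν x hν hx
  rwa [BesselAux.HH_re hν hx0, BesselAux.HH_im hx0] at h
end
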